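/- arXiv:2001.07144 — 6 statements merged into one kernel-verified Lean document; each statement's English description precedes it below -/
import Mathlib

section
/- Let ℓ ≥ 0 be an integer, r > 0, y ∈ ℂ, and let φ be a continuous complex-valued function on the circle {z ∈ ℂ : |z−y| = r}. Then | (1/(2πi)) ∮_{|z−y|=r} e^{−z ȳ} φ(z) (z−y)^{−(ℓ+1)} dz |² ≤ (e^{r²} / (2π r^{2ℓ+1})) ∮_{|z−y|=r} e^{−|z|² − |y|²} |φ(z)|² |dz|, where |dz| denotes the arclength measure on the circle. -/
open MeasureTheory Metric Filter Real

lemma aux_cs (g : ℝ → ℝ) (hg : Continuous g) :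
    (1 / (2 * π) * ∫ θ in (0 : ℝ)..(2 * π), g θ) ^ 2
      ≤ 1 / (2 * π) * ∫ θ in (0 : ℝ)..(2 * π), g θ ^ 2 := by
  have hpi := Real.pi_pos
  set A := ∫ θ in (0 : ℝ)..(2 * π), g θ with hA
  set m := 1 / (2 * π) * A with hm
  have h0 : 0 ≤ ∫ θ in (0 : ℝ)..(2 * π), (g θ - m) ^ 2 :=
    intervalIntegral.integral_nonneg (by positivity) (fun _ _ => sq_nonneg _)
  have h1 : ∫ θ in (0 : ℝ)..(2 * π), (g θ - m) ^ 2
      = (∫ θ in (0 : ℝ)..(2 * π), g θ ^ 2) - 2 * m * A + 2 * π * m ^ 2 := by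
    have e : ∀ θ, (g θ - m) ^ 2 = g θ ^ 2 - 2 * m * g θ + m ^ 2 := fun θ => by ring
    simp only [e]
    rw [intervalIntegral.integral_add, intervalIntegral.integral_sub,
      intervalIntegral.integral_const_mul, intervalIntegral.integral_const]
    · simp [hA]
    all_goals exact Continuous.intervalIntegrable (by fun_prop) _ _
  have h2 : A = 2 * π * m := by rw [hm]; field_simp
  rw [h1, h2] at h0
  rw [one_div, inv_mul_eq_div, le_div_iff₀ (by positivity)]
  nlinarith

/-- **Cauchy–Schwarz bound for the Dyson contour term.** The arclength integral
`∮_{|z−y|=r} … |dz|` is written as `∫_0^{2π} … r dθ` via the parametrization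
`θ ↦ circleMap y r θ = y + r e^{iθ}`. -/
theorem contour_term_cauchy_schwarz (ℓ : ℕ) (r : ℝ) (hr : 0 < r) (y : ℂ)
    (φ : ℂ → ℂ) (hφ : ContinuousOn φ (sphere y r)) :
    ‖(1 / (2 * π * Complex.I)) *
        ∮ z in C(y, r),
          Complex.exp (-(z * (starRingEnd ℂ) y)) * φ z / (z - y) ^ (ℓ + 1)‖ ^ 2
      ≤ Real.exp (r ^ 2) / (2 * π * r ^ (2 * ℓ + 1)) *
          ∫ θ in (0 : ℝ)..(2 * π),
            Real.exp (-‖circleMap y r θ‖ ^ 2 - ‖y‖ ^ 2) *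
              ‖φ (circleMap y r θ)‖ ^ 2 * r := by
  have hpi := Real.pi_pos
  have hc : Continuous fun θ => φ (circleMap y r θ) :=
    hφ.comp_continuous (continuous_circleMap y r) (fun θ => circleMap_mem_sphere y hr.le θ)
  set g : ℝ → ℝ := fun θ =>
    Real.exp (-(circleMap y r θ * (starRingEnd ℂ) y).re) * ‖φ (circleMap y r θ)‖ / r ^ ℓ with hgdef
  have hg : Continuous g := by
    have := continuous_circleMap y r
    have h3 : Continuous fun θ => (circleMap y r θ * (starRingEnd ℂ) y).re :=
      Complex.continuous_re.comp (this.mul continuous_const)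
    exact ((Real.continuous_exp.comp h3.neg).mul hc.norm).div_const _
  have hnorm : ‖(1 / (2 * π * Complex.I)) *
        ∮ z in C(y, r),
          Complex.exp (-(z * (starRingEnd ℂ) y)) * φ z / (z - y) ^ (ℓ + 1)‖
      ≤ 1 / (2 * π) * ∫ θ in (0 : ℝ)..(2 * π), g θ := by
    rw [norm_mul]
    have : ‖(1 / (2 * π * Complex.I) : ℂ)‖ = 1 / (2 * π) := by
      simp [abs_of_pos hpi]
    rw [this]
    refine mul_le_mul_of_nonneg_left ?_ (by positivity)
    rw [circleIntegral]
    refine (intervalIntegral.norm_integral_le_integral_norm (by positivity)).trans (le_of_eq ?_)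
    refine intervalIntegral.integral_congr (fun θ _ => ?_)
    simp only [hgdef, norm_smul, norm_div, norm_mul, norm_pow, Complex.norm_exp, deriv_circleMap,
      Complex.norm_I, norm_circleMap_zero, circleMap_sub_center, abs_of_pos hr, Complex.neg_re]
    field_simp
    ring
  refine (pow_le_pow_left₀ (norm_nonneg _) hnorm 2).trans ((aux_cs g hg).trans (le_of_eq ?_))
  rw [← intervalIntegral.integral_const_mul, ← intervalIntegral.integral_const_mul]
  refine intervalIntegral.integral_congr (fun θ _ => ?_)
  have key : -‖circleMap y r θ‖ ^ 2 - ‖y‖ ^ 2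
      = 2 * (-(circleMap y r θ * (starRingEnd ℂ) y).re) - r ^ 2 := by
    have h : ‖circleMap y r θ - y‖ ^ 2 = r ^ 2 := by simp [circleMap_sub_center]
    rw [← Complex.normSq_eq_norm_sq, Complex.normSq_sub, Complex.normSq_eq_norm_sq,
      Complex.normSq_eq_norm_sq] at h
    linarith
  simp only [hgdef]
  rw [key, Real.exp_sub]
  generalize -(circleMap y r θ * (starRingEnd ℂ) y).re = E
  have hE : Real.exp (2 * E) = Real.exp E ^ 2 := by rw [two_mul, Real.exp_add, sq]
  rw [hE]
  have h1 := (Real.exp_pos (r ^ 2)).ne'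
  generalize Real.exp (r ^ 2) = F at *
  generalize Real.exp E = G
  field_simp
  try ring
end

section
/- Let ℓ ≥ 0 be an integer, let ρ : [0,∞) → [0,∞) be measurable, and let φ : ℂ × ℂ → ℂ be continuous. Then, with both sides allowed to be +∞, ∫_{ℂ} ∫_0^∞ e^{−r²} ρ(r) | (1/(2πi)) ∮_{|z−y|=r} e^{−z ȳ} φ(z,y) (z−y)^{−(ℓ+1)} dz |² dr dA(y) ≤ (1/(2π)) ∫_{ℂ×ℂ} e^{−|z|² − |y|²} |φ(z,y)|² ρ(|z−y|) |z−y|^{−(2ℓ+1)} dA(z) dA(y), where dA denotes Lebesgue (area) measure on ℂ ≅ ℝ². -/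
open MeasureTheory Metric Filter Real

lemma cs_aux (g : ℝ → ℝ) (hg : Continuous g) :
    (∫ t in (-π)..π, g t) ^ 2 ≤ 2 * π * ∫ t in (-π)..π, g t ^ 2 := by
  set I := ∫ t in (-π)..π, g t with hI
  set c := I / (2 * π) with hc
  have h0 : 0 ≤ ∫ t in (-π)..π, (g t - c) ^ 2 :=
    intervalIntegral.integral_nonneg (by linarith [pi_pos]) (fun t _ => sq_nonneg _)
  have h1 : ∫ t in (-π)..π, (g t - c) ^ 2
      = (∫ t in (-π)..π, g t ^ 2) - 2 * c * I + 2 * π * c ^ 2 := by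
    have : ∀ t, (g t - c) ^ 2 = (g t ^ 2 - 2 * c * g t) + c ^ 2 := fun t => by ring
    simp_rw [this]
    rw [intervalIntegral.integral_add, intervalIntegral.integral_sub,
      intervalIntegral.integral_const_mul, intervalIntegral.integral_const]
    · simp only [smul_eq_mul]; ring
    all_goals exact Continuous.intervalIntegrable (by fun_prop) _ _
  have hcI : I = 2 * π * c := by rw [hc]; field_simp
  rw [h1, hcI] at h0
  rw [hcI]
  nlinarith [pi_pos]

lemma circle_aux (f : ℂ → ℂ) 
    (y : ℂ) (r : ℝ) (hr : 0 < r) (hf : Continuous fun t => f (circleMap y r t)) :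
    ‖(1 / (2 * π * Complex.I)) * ∮ z in C(y, r), f z‖ ^ 2
      ≤ 1 / (2 * π) * ∫ t in (-π)..π, (r * ‖f (circleMap y r t)‖) ^ 2 := by
  have e : (∮ z in C(y, r), f z)
      = ∫ t in (-π)..π, deriv (circleMap y r) t • f (circleMap y r t) := by
    have hp : Function.Periodic (fun t => deriv (circleMap y r) t • f (circleMap y r t))
        (2 * π) := by
      intro t
      simp only [deriv_circleMap, periodic_circleMap y r t, periodic_circleMap 0 r t]
    have := hp.intervalIntegral_add_eq 0 (-π)
    rw [circleIntegral, ← zero_add (2 * π), this]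
    congr 1; ring
  have n1 : ‖∮ z in C(y, r), f z‖ ≤ ∫ t in (-π)..π, r * ‖f (circleMap y r t)‖ := by
    rw [e]
    refine (intervalIntegral.norm_integral_le_integral_norm (by linarith [pi_pos])).trans
      (le_of_eq ?_)
    congr 1; ext t
    simp [deriv_circleMap, abs_of_pos hr]
  have n2 := cs_aux (fun t => r * ‖f (circleMap y r t)‖)
    (continuous_const.mul hf.norm)
  have n3 : ‖∮ z in C(y, r), f z‖ ^ 2 ≤ (∫ t in (-π)..π, r * ‖f (circleMap y r t)‖) ^ 2 := by
    gcongr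
  have n4 : ‖(1 / (2 * π * Complex.I) : ℂ)‖ = 1 / (2 * π) := by
    simp [abs_of_pos pi_pos]
  rw [norm_mul, n4, mul_pow]
  calc _ ≤ (1 / (2 * π)) ^ 2 * (2 * π * ∫ t in (-π)..π, (r * ‖f (circleMap y r t)‖) ^ 2) := by
        gcongr; exact n3.trans n2
    _ = _ := by field_simp

lemma exp_aux (y z : ℂ) (r : ℝ) (h : ‖z - y‖ = r) :
    Real.exp (-r ^ 2) * ‖Complex.exp (-(z * (starRingEnd ℂ) y))‖ ^ 2
      = Real.exp (-‖z‖ ^ 2 - ‖y‖ ^ 2) := by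
  rw [Complex.norm_exp, ← Real.exp_nat_mul, ← Real.exp_add, ← h]
  congr 1
  simp only [← Complex.normSq_eq_norm_sq, Complex.normSq_apply]
  simp
  ring

lemma polar_aux (y : ℂ) (F : ℂ → ENNReal) (hF : Measurable F) :
    ∫⁻ z, F z = ∫⁻ r in Set.Ioi (0 : ℝ), ∫⁻ t in Set.Ioo (-π) π,
      ENNReal.ofReal r * F (circleMap y r t) := by
  rw [← lintegral_add_left_eq_self F y, ← Complex.lintegral_comp_polarCoord_symm,
    polarCoord_target, Measure.volume_eq_prod, ← Measure.prod_restrict, lintegral_prod]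
  · simp only [Complex.polarCoord_symm_apply, smul_eq_mul, circleMap, Complex.exp_mul_I]
    simp
  · apply Measurable.aemeasurable
    have : Measurable fun p : ℝ × ℝ => Complex.polarCoord.symm p := by
      simp only [Complex.polarCoord_symm_apply]
      fun_prop
    simp only [smul_eq_mul]
    fun_prop

/-- **Integrated Cauchy–Schwarz bound for the Dyson contour term.** Both sides are
extended-real-valued integrals (allowed to be `+∞`). -/
theorem contour_term_integrated_bound (ℓ : ℕ)
    (ρ : ℝ → ℝ) (hρ_meas : Measurable ρ) (hρ_nonneg : ∀ r, 0 ≤ ρ r)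
    (φ : ℂ × ℂ → ℂ) (hφ : Continuous φ) :
    (∫⁻ y : ℂ, ∫⁻ r in Set.Ioi (0 : ℝ),
        ENNReal.ofReal (Real.exp (-r ^ 2) * ρ r *
          ‖(1 / (2 * π * Complex.I)) *
            ∮ z in C(y, r),
              Complex.exp (-(z * (starRingEnd ℂ) y)) * φ (z, y) / (z - y) ^ (ℓ + 1)‖ ^ 2))
      ≤ ENNReal.ofReal (1 / (2 * π)) *
          ∫⁻ y : ℂ, ∫⁻ z : ℂ,
            ENNReal.ofReal (Real.exp (-‖z‖ ^ 2 - ‖y‖ ^ 2) * ‖φ (z, y)‖ ^ 2 *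
              ρ ‖z - y‖ / ‖z - y‖ ^ (2 * ℓ + 1)) := by
  rw [← lintegral_const_mul' _ _ ENNReal.ofReal_ne_top]
  refine lintegral_mono fun y => ?_
  have hφy : Continuous fun z => φ (z, y) := by fun_prop
  simp only []
  rw [polar_aux y _ (by
    have := hφy.measurable
    fun_prop), ← lintegral_const_mul' _ _ ENNReal.ofReal_ne_top]
  refine setLIntegral_mono' measurableSet_Ioi fun r hr => ?_
  have hr : 0 < r := hr
  have key : ∀ t, circleMap y r t - y = circleMap 0 r t := fun t => by simp [circleMap]
  have nkey : ∀ t, ‖circleMap y r t - y‖ = r := fun t => by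
    rw [key]; simp [abs_of_pos hr]
  set f : ℂ → ℂ := fun z =>
    Complex.exp (-(z * (starRingEnd ℂ) y)) * φ (z, y) / (z - y) ^ (ℓ + 1) with hf
  have hcont : Continuous fun t => f (circleMap y r t) := by
    simp only [hf]
    refine Continuous.div ?_ ?_ ?_
    · have := continuous_circleMap y r
      fun_prop
    · have := continuous_circleMap y r
      fun_prop
    · intro t
      refine pow_ne_zero _ ?_
      rw [← norm_pos_iff, nkey]; exact hr
  have b := circle_aux f y r hr hcont
  have b2 : Real.exp (-r ^ 2) * ρ r * ‖(1 / (2 * π * Complex.I)) * ∮ z in C(y, r), f z‖ ^ 2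
      ≤ 1 / (2 * π) * ∫ t in (-π)..π,
        Real.exp (-r ^ 2) * ρ r * (r * ‖f (circleMap y r t)‖) ^ 2 := by
    rw [intervalIntegral.integral_const_mul]
    calc _ ≤ Real.exp (-r ^ 2) * ρ r * (1 / (2 * π) *
          ∫ t in (-π)..π, (r * ‖f (circleMap y r t)‖) ^ 2) :=
          mul_le_mul_of_nonneg_left b (mul_nonneg (Real.exp_pos _).le (hρ_nonneg r))
      _ = _ := by ring
  refine (ENNReal.ofReal_le_ofReal b2).trans ?_
  rw [ENNReal.ofReal_mul (by positivity)]
  gcongr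
  have hc2 : Continuous fun t => Real.exp (-r ^ 2) * ρ r * (r * ‖f (circleMap y r t)‖) ^ 2 :=
    continuous_const.mul ((continuous_const.mul hcont.norm).pow 2)
  rw [intervalIntegral.integral_of_le (by linarith [pi_pos]), integral_Ioc_eq_integral_Ioo,
    ofReal_integral_eq_lintegral_ofReal]
  · refine lintegral_mono fun t => ?_
    simp only []
    rw [← ENNReal.ofReal_mul hr.le]
    refine le_of_eq (congrArg _ ?_)
    rw [nkey, ← exp_aux y _ r (nkey t)]
    simp only [hf, norm_div, norm_mul, norm_pow, nkey]
    field_simp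
    ring
  · exact (hc2.integrableOn_Icc (a := -π) (b := π)).mono_set Set.Ioo_subset_Icc_self
  · exact Eventually.of_forall fun t =>
      mul_nonneg (mul_nonneg (Real.exp_pos _).le (hρ_nonneg r)) (sq_nonneg _)
end

section
/- Let φ : ℝ² → ℂ be a continuously differentiable function with compact support, and set Ψ(x) = e^{−|x|²/2} φ(x). Then ∫_{ℝ²} ( | −i ∂₁Ψ(x) + x² Ψ(x) |² + | −i ∂₂Ψ(x) − x¹ Ψ(x) |² ) dx − 2 ∫_{ℝ²} |Ψ(x)|² dx = 4 ∫_{ℝ²} e^{−|x|²} | ∂_{z̄}φ(x) |² dx. Equivalently, the quadratic form of the shifted magnetic Laplacian h = (−i∇ − x^⊥)² − 2 satisfies ⟨Ψ, hΨ⟩ = 4 ∫_{ℝ²} e^{−|x|²} |∂_{z̄}φ|² dx. -/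
open MeasureTheory Metric Filter Real

/-- The Wirtinger derivative `∂_{z̄}φ = ½(∂₁φ + i ∂₂φ)`, identifying `ℝ² ≅ ℂ`. -/
noncomputable def dbar (φ : ℂ → ℂ) (x : ℂ) : ℂ :=
  (1 / 2) * (fderiv ℝ φ x 1 + Complex.I * fderiv ℝ φ x Complex.I)

/-- The lowest-Landau-level dressed wave function `Ψ(x) = e^{−|x|²/2} φ(x)`. -/
noncomputable def dressed (φ : ℂ → ℂ) (x : ℂ) : ℂ :=
  (Real.exp (-‖x‖ ^ 2 / 2) : ℝ) * φ x

lemma cs_int {g : ℂ → ℝ} (hg : Continuous g) (hc : HasCompactSupport g) : Integrable g :=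
  hg.integrable_of_hasCompactSupport hc

lemma int_fun_sub {f g : ℂ → ℝ} (hf : Integrable f) (hg : Integrable g) :
    Integrable (fun x => f x - g x) := hf.sub hg

lemma cont_dir {f : ℂ → ℝ} (hf : ContDiff ℝ 1 f) (v : ℂ) :
    Continuous (fun x => fderiv ℝ f x v) :=
  (hf.continuous_fderiv one_ne_zero).clm_apply continuous_const

lemma cs_dir {f : ℂ → ℝ} (hc : HasCompactSupport f) (v : ℂ) :
    HasCompactSupport (fun x => fderiv ℝ f x v) := hc.fderiv_apply ℝ v

lemma int_parts {f g : ℂ → ℝ} (hf : ContDiff ℝ 1 f) (hg : ContDiff ℝ 1 g)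
    (hgc : HasCompactSupport g) (w : ℂ) :
    ∫ x, f x * fderiv ℝ g x w = - ∫ x, fderiv ℝ f x w * g x := by
  apply integral_mul_fderiv_eq_neg_fderiv_mul_of_integrable
  · exact cs_int ((cont_dir hf w).mul hg.continuous) hgc.mul_left
  · exact cs_int (hf.continuous.mul (cont_dir hg w)) (cs_dir hgc w).mul_left
  · exact cs_int (hf.continuous.mul hg.continuous) hgc.mul_left
  · exact fun x _ => (hf.differentiable one_ne_zero) x
  · exact fun x _ => (hg.differentiable one_ne_zero) x

lemma int_dir {g : ℂ → ℝ} (hg : ContDiff ℝ 1 g)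
    (hgc : HasCompactSupport g) (w : ℂ) : ∫ x, fderiv ℝ g x w = 0 := by
  have := int_parts (f := fun _ => (1 : ℝ)) contDiff_const hg hgc w
  simpa using this

/-- Weak symmetry of second derivatives. -/
lemma mixed {f g : ℂ → ℝ} (hf : ContDiff ℝ 1 f) (hfc : HasCompactSupport f)
    (hg : ContDiff ℝ 1 g) (hgc : HasCompactSupport g) (v w : ℂ) :
    ∫ x, fderiv ℝ f x v * fderiv ℝ g x w = ∫ x, fderiv ℝ f x w * fderiv ℝ g x v := by
  obtain ⟨C, hC⟩ := hf.lipschitzWith_of_hasCompactSupport hfc one_ne_zero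
  obtain ⟨D, hD⟩ := hg.lipschitzWith_of_hasCompactSupport hgc one_ne_zero
  have A := LipschitzWith.integral_inv_smul_sub_mul_tendsto_integral_lineDeriv_mul'
    (μ := (volume : Measure ℂ)) hC hfc (cont_dir hg w) v
  have B := LipschitzWith.integral_inv_smul_sub_mul_tendsto_integral_lineDeriv_mul'
    (μ := (volume : Measure ℂ)) hD hgc (cont_dir hf w) (-v)
  have hdf : ∀ x u, lineDeriv ℝ f x u = fderiv ℝ f x u := fun x u =>
    ((hf.differentiable one_ne_zero) x).lineDeriv_eq_fderiv
  have hdg : ∀ x u, lineDeriv ℝ g x u = fderiv ℝ g x u := fun x u =>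
    ((hg.differentiable one_ne_zero) x).lineDeriv_eq_fderiv
  simp only [hdf] at A
  simp only [hdg] at B
  have key : ∀ t : ℝ, ∫ x, (t⁻¹ • (f (x + t • v) - f x)) * fderiv ℝ g x w
      = - ∫ x, (t⁻¹ • (g (x + t • (-v)) - g x)) * fderiv ℝ f x w := by
    intro t
    have hft : ContDiff ℝ 1 (fun x => f (x + t • v)) := hf.comp (by fun_prop)
    have h1 : ∫ x, (t⁻¹ • (f (x + t • v) - f x)) * fderiv ℝ g x w
        = - ∫ x, (t⁻¹ • (fderiv ℝ f (x + t • v) w - fderiv ℝ f x w)) * g x := by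
      have := int_parts (f := fun x => t⁻¹ • (f (x + t • v) - f x))
        ((hft.sub hf).const_smul _) hg hgc w
      rw [this]
      congr 2
      ext x
      rw [fderiv_fun_const_smul, fderiv_fun_sub, fderiv_comp_add_right]
      · simp
      · exact (hft.differentiable one_ne_zero) x
      · exact (hf.differentiable one_ne_zero) x
      · exact ((hft.sub hf).differentiable one_ne_zero) x
    rw [h1]
    congr 1
    simp only [smul_eq_mul, mul_assoc, integral_const_mul]
    congr 1
    have S3 : ∫ x, fderiv ℝ f (x + t • v) w * g x = ∫ x, g (x + t • (-v)) * fderiv ℝ f x w := by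
      rw [← integral_add_right_eq_self _ (t • (-v))]
      simp [mul_comm]
    have cft : Continuous (fun x => fderiv ℝ f (x + t • v) w) :=
      (cont_dir hf w).comp (by fun_prop)
    have cgt : Continuous (fun x => g (x + t • (-v))) := hg.continuous.comp (by fun_prop)
    simp_rw [_root_.sub_mul]
    rw [integral_sub, integral_sub, S3]
    · simp_rw [mul_comm]
    · exact cs_int (cgt.mul (cont_dir hf w)) (cs_dir hfc w).mul_left
    · exact cs_int (hg.continuous.mul (cont_dir hf w)) (cs_dir hfc w).mul_left
    · exact cs_int (cft.mul hg.continuous) hgc.mul_left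
    · exact cs_int ((cont_dir hf w).mul hg.continuous) hgc.mul_left
  simp only [key] at A
  have := tendsto_nhds_unique A B.neg
  rw [this, ← integral_neg]
  congr 1
  ext x
  simp [mul_comm]

lemma hasFDerivAt_gauss (c : ℝ) (x : ℂ) :
    HasFDerivAt (fun x : ℂ => Real.exp (-‖x‖ ^ 2 / c))
      (Real.exp (-‖x‖ ^ 2 / c) • ((-2 / c) • (innerSL ℝ x))) x := by
  have h := (((hasStrictFDerivAt_norm_sq x).hasFDerivAt.fun_neg).mul_const (c⁻¹)).exp
  simp only [← div_eq_mul_inv] at h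
  refine h.congr_fderiv ?_
  ext <;> simp <;> ring

lemma contDiff_gauss (c : ℝ) : ContDiff ℝ 1 (fun x : ℂ => Real.exp (-‖x‖ ^ 2 / c)) := by
  have := contDiff_norm_sq ℝ (E := ℂ) (n := 1)
  fun_prop

lemma fderiv_dressed {φ : ℂ → ℂ} (hφ : ContDiff ℝ 1 φ) (x v : ℂ) :
    fderiv ℝ (dressed φ) x v = (Real.exp (-‖x‖ ^ 2 / 2) : ℝ) *
      (fderiv ℝ φ x v - ((x.re * v.re + x.im * v.im : ℝ) : ℂ) * φ x) := by
  have h := (hasFDerivAt_gauss 2 x).smul ((hφ.differentiable one_ne_zero) x).hasFDerivAt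
  have e : dressed φ = (fun x : ℂ => Real.exp (-‖x‖ ^ 2 / 2)) • φ := by
    ext x; simp [dressed]
  rw [e, h.fderiv]
  simp [Complex.inner]
  ring

/-- **Quadratic form of the shifted magnetic Laplacian `h = (−i∇ − x^⊥)² − 2`.**
Identifying `x = (x¹,x²) ∈ ℝ²` with `z = x¹ + ix² ∈ ℂ`, and with
`(−i∇ − x^⊥)Ψ = (−i∂₁Ψ + x²Ψ, −i∂₂Ψ − x¹Ψ)`, for `Ψ = e^{−|x|²/2}φ` one has
`⟨Ψ, hΨ⟩ = 4∫ e^{−|x|²} |∂_{z̄}φ|² dx`. -/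
theorem magnetic_form_identity (φ : ℂ → ℂ) (hφ : ContDiff ℝ 1 φ)
    (hφc : HasCompactSupport φ) :
    (∫ x : ℂ,
        (‖-Complex.I * fderiv ℝ (dressed φ) x 1 + (x.im : ℂ) * dressed φ x‖ ^ 2 +
          ‖-Complex.I * fderiv ℝ (dressed φ) x Complex.I - (x.re : ℂ) * dressed φ x‖ ^ 2))
      - 2 * ∫ x : ℂ, ‖dressed φ x‖ ^ 2
      = 4 * ∫ x : ℂ, Real.exp (-‖x‖ ^ 2) * ‖dbar φ x‖ ^ 2 := by
  set w : ℂ → ℝ := fun x => Real.exp (-‖x‖ ^ 2 / 1) with hw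
  have cw : ContDiff ℝ 1 w := contDiff_gauss 1
  set u : ℂ → ℝ := fun x => (φ x).re with hu
  set v : ℂ → ℝ := fun x => (φ x).im with hv
  have cu : ContDiff ℝ 1 u := Complex.reCLM.contDiff.comp hφ
  have cv : ContDiff ℝ 1 v := Complex.imCLM.contDiff.comp hφ
  have su : HasCompactSupport u := hφc.comp_left (g := Complex.re) rfl
  have sv : HasCompactSupport v := hφc.comp_left (g := Complex.im) rfl
  have dφ : ∀ x, HasFDerivAt φ (fderiv ℝ φ x) x := fun x =>
    ((hφ.differentiable one_ne_zero) x).hasFDerivAt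
  have du : ∀ x, HasFDerivAt u (fderiv ℝ u x) x := fun x =>
    ((cu.differentiable one_ne_zero) x).hasFDerivAt
  have dv : ∀ x, HasFDerivAt v (fderiv ℝ v x) x := fun x =>
    ((cv.differentiable one_ne_zero) x).hasFDerivAt
  have eu : ∀ x y, fderiv ℝ u x y = (fderiv ℝ φ x y).re := fun x y => by
    exact congrArg (fun L => L y) (Complex.reCLM.hasFDerivAt.comp x (dφ x)).fderiv
  have ev : ∀ x y, fderiv ℝ v x y = (fderiv ℝ φ x y).im := fun x y => by
    exact congrArg (fun L => L y) (Complex.imCLM.hasFDerivAt.comp x (dφ x)).fderiv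
  have cre : ContDiff ℝ 1 Complex.re := Complex.reCLM.contDiff
  have cim : ContDiff ℝ 1 Complex.im := Complex.imCLM.contDiff
  set F : ℂ → ℝ := fun x => w x * u x with hF
  set G : ℂ → ℝ := fun x => w x * v x with hG
  set P : ℂ → ℝ := fun x => (F x * u x + G x * v x) * x.re with hP
  set Q : ℂ → ℝ := fun x => (F x * u x + G x * v x) * x.im with hQ
  have cF : ContDiff ℝ 1 F := cw.mul cu
  have cG : ContDiff ℝ 1 G := cw.mul cv
  have cP : ContDiff ℝ 1 P := ((cF.mul cu).add (cG.mul cv)).mul cre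
  have cQ : ContDiff ℝ 1 Q := ((cF.mul cu).add (cG.mul cv)).mul cim
  have sF : HasCompactSupport F := su.mul_left
  have sG : HasCompactSupport G := sv.mul_left
  have sN : HasCompactSupport (fun x => F x * u x + G x * v x) :=
    (HasCompactSupport.mul_left su).add (HasCompactSupport.mul_left sv)
  have sP : HasCompactSupport P := sN.mul_right
  have sQ : HasCompactSupport Q := sN.mul_right
  have dF : ∀ x y, fderiv ℝ F x y =
      w x * (fderiv ℝ u x y - 2 * (x.re * y.re + x.im * y.im) * u x) := fun x y => by
    refine (congrArg (fun L => L y) ((hasFDerivAt_gauss 1 x).mul (du x)).fderiv).trans ?_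
    simp [Complex.inner, hw]; ring
  have dG : ∀ x y, fderiv ℝ G x y =
      w x * (fderiv ℝ v x y - 2 * (x.re * y.re + x.im * y.im) * v x) := fun x y => by
    refine (congrArg (fun L => L y) ((hasFDerivAt_gauss 1 x).mul (dv x)).fderiv).trans ?_
    simp [Complex.inner, hw]; ring
  have dF' : ∀ x, HasFDerivAt F (fderiv ℝ F x) x := fun x =>
    ((cF.differentiable one_ne_zero) x).hasFDerivAt
  have dG' : ∀ x, HasFDerivAt G (fderiv ℝ G x) x := fun x =>
    ((cG.differentiable one_ne_zero) x).hasFDerivAt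
  have dP : ∀ x y, fderiv ℝ P x y = (F x * u x + G x * v x) * y.re +
      x.re * (F x * fderiv ℝ u x y + u x * fderiv ℝ F x y +
        (G x * fderiv ℝ v x y + v x * fderiv ℝ G x y)) := fun x y => by
    have h := ((((dF' x).mul (du x)).add ((dG' x).mul (dv x))).mul
      (Complex.reCLM.hasFDerivAt (x := x))).fderiv
    refine (congrArg (fun L => L y) h).trans ?_
    simp; ring
  have dQ : ∀ x y, fderiv ℝ Q x y = (F x * u x + G x * v x) * y.im +
      x.im * (F x * fderiv ℝ u x y + u x * fderiv ℝ F x y +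
        (G x * fderiv ℝ v x y + v x * fderiv ℝ G x y)) := fun x y => by
    have h := ((((dF' x).mul (du x)).add ((dG' x).mul (dv x))).mul
      (Complex.imCLM.hasFDerivAt (x := x))).fderiv
    refine (congrArg (fun L => L y) h).trans ?_
    simp; ring
  have hsq : ∀ x : ℂ, Real.exp (-‖x‖ ^ 2 / 2) ^ 2 = w x := fun x => by
    rw [hw, ← Real.exp_nat_mul]; congr 1; push_cast; ring
  have hw1 : ∀ x : ℂ, Real.exp (-‖x‖ ^ 2) = w x := fun x => by simp [hw]
  have hN : ∀ x, ‖dressed φ x‖ ^ 2 = F x * u x + G x * v x := fun x => by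
    rw [dressed, norm_mul, mul_pow, Complex.norm_real, Real.norm_eq_abs, sq_abs, hsq,
      Complex.sq_norm, Complex.normSq_apply]
    simp only [hF, hG, hu, hv]; ring
  have hK : ∀ x, Real.exp (-‖x‖ ^ 2) * ‖dbar φ x‖ ^ 2 = (1 / 4) * (w x *
      ((fderiv ℝ u x 1 - fderiv ℝ v x Complex.I) ^ 2 +
        (fderiv ℝ v x 1 + fderiv ℝ u x Complex.I) ^ 2)) := fun x => by
    rw [hw1, dbar, norm_mul, mul_pow, Complex.sq_norm (_ + _), Complex.normSq_apply]
    simp only [eu, ev]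
    simp
    ring
  have hM : ∀ x, ‖-Complex.I * fderiv ℝ (dressed φ) x 1 + (x.im : ℂ) * dressed φ x‖ ^ 2 +
          ‖-Complex.I * fderiv ℝ (dressed φ) x Complex.I - (x.re : ℂ) * dressed φ x‖ ^ 2
      = 2 * (F x * u x + G x * v x) + (w x *
      ((fderiv ℝ u x 1 - fderiv ℝ v x Complex.I) ^ 2 +
        (fderiv ℝ v x 1 + fderiv ℝ u x Complex.I) ^ 2)) - fderiv ℝ P x 1 - fderiv ℝ Q x Complex.I
      + fderiv ℝ F x 1 * fderiv ℝ v x Complex.I - fderiv ℝ F x Complex.I * fderiv ℝ v x 1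
      - fderiv ℝ G x 1 * fderiv ℝ u x Complex.I + fderiv ℝ G x Complex.I * fderiv ℝ u x 1 := by
    intro x
    simp only [dP, dQ, dF, dG, eu, ev]
    simp only [fderiv_dressed hφ, dressed, hF, hG, ← hsq, hu, hv]
    generalize Real.exp (-‖x‖ ^ 2 / 2) = E
    simp only [Complex.sq_norm, Complex.normSq_apply]
    simp
    ring
  have iN : Integrable (fun x => F x * u x + G x * v x) :=
    cs_int ((cF.mul cu).add (cG.mul cv)).continuous sN
  have iK : Integrable (fun x => w x * ((fderiv ℝ u x 1 - fderiv ℝ v x Complex.I) ^ 2 +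
        (fderiv ℝ v x 1 + fderiv ℝ u x Complex.I) ^ 2)) := by
    have c1 := cont_dir cu 1
    have c2 := cont_dir cu Complex.I
    have c3 := cont_dir cv 1
    have c4 := cont_dir cv Complex.I
    have c5 := cw.continuous
    refine cs_int (by fun_prop) (HasCompactSupport.mul_left (HasCompactSupport.add ?_ ?_))
    · simp only [pow_two]
      exact HasCompactSupport.mul_left ((cs_dir su 1).sub (cs_dir sv Complex.I))
    · simp only [pow_two]
      exact HasCompactSupport.mul_left ((cs_dir sv 1).add (cs_dir su Complex.I))
  have iD : ∀ {f : ℂ → ℝ}, ContDiff ℝ 1 f → HasCompactSupport f → ∀ y,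
      Integrable (fun x => fderiv ℝ f x y) := fun hf hc y => cs_int (cont_dir hf y) (cs_dir hc y)
  have iDD : ∀ {f g : ℂ → ℝ}, ContDiff ℝ 1 f → ContDiff ℝ 1 g → HasCompactSupport g → ∀ y z,
      Integrable (fun x => fderiv ℝ f x y * fderiv ℝ g x z) := fun hf hg hc y z =>
    cs_int ((cont_dir hf y).mul (cont_dir hg z)) (cs_dir hc z).mul_left
  have j1 := (iN.const_mul 2).fun_add iK
  have j2 := int_fun_sub j1 (iD cP sP 1)
  have j3 := int_fun_sub j2 (iD cQ sQ Complex.I)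
  have j4 := j3.fun_add (iDD cF cv sv 1 Complex.I)
  have j5 := int_fun_sub j4 (iDD cF cv sv Complex.I 1)
  have j6 := int_fun_sub j5 (iDD cG cu su 1 Complex.I)
  simp_rw [hM, hK, hN]
  rw [integral_add j6 (iDD cG cu su Complex.I 1), integral_sub j5 (iDD cG cu su 1 Complex.I),
    integral_sub j4 (iDD cF cv sv Complex.I 1), integral_add j3 (iDD cF cv sv 1 Complex.I),
    integral_sub j2 (iD cQ sQ Complex.I), integral_sub j1 (iD cP sP 1),
    integral_add (iN.const_mul 2) iK, integral_const_mul, integral_const_mul,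
    int_dir cP sP, int_dir cQ sQ, mixed cF sF cv sv 1 Complex.I, mixed cG sG cu su 1 Complex.I]
  ring
end

section
/- Let ℓ ≥ 1 be an integer and R₀ > 0. Then inf { ∫_{ℝ²} |x|^{2ℓ} |∇f(x)|² dx : f : ℝ² → ℝ locally Lipschitz, f(x) = 0 for |x| ≤ R₀, lim_{|x|→∞} f(x) = 1 } = 4π ℓ R₀^{2ℓ}, and the infimum is attained by f*(x) = max(0, 1 − (R₀/|x|)^{2ℓ}). In other words, the scattering parameter of the hard disc of radius R₀ in channel ℓ equals b_ℓ = R₀^{2ℓ}. -/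
open MeasureTheory Metric Filter Real
open scoped ENNReal

/-- The weighted Dirichlet energy `∫_{ℝ²} |x|^{2ℓ} |∇f(x)|² dx` (the gradient of a
locally Lipschitz function exists almost everywhere by Rademacher's theorem, and
`fderiv` is interpreted as `0` on the null set where it does not exist). -/
noncomputable def hardDiscEnergy (ℓ : ℕ) (f : ℂ → ℝ) : ℝ≥0∞ :=
  ∫⁻ x : ℂ, ENNReal.ofReal (‖x‖ ^ (2 * ℓ) * ‖fderiv ℝ f x‖ ^ 2)

/-- Admissible trial functions for the hard disc of radius `R₀`: locally Lipschitz,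
vanishing on the disc `{|x| ≤ R₀}`, and tending to `1` at infinity. -/
def hardDiscAdmissible (R₀ : ℝ) : Set (ℂ → ℝ) :=
  {f | LocallyLipschitz f ∧ (∀ x : ℂ, ‖x‖ ≤ R₀ → f x = 0) ∧
    Filter.Tendsto f (Filter.cocompact ℂ) (nhds 1)}

/-- The explicit minimizer `f*(x) = max(0, 1 − (R₀/|x|)^{2ℓ})` for the hard disc
(equal to `0` on the disc, including at the origin). -/
noncomputable def hardDiscMinimizer (ℓ : ℕ) (R₀ : ℝ) (x : ℂ) : ℝ :=
  if ‖x‖ ≤ R₀ then 0 else 1 - (R₀ / ‖x‖) ^ (2 * ℓ)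

lemma hd_deriv (n : ℕ) (R r : ℝ) (hr : 0 < r) :
    HasDerivAt (fun r : ℝ => 1 - (R / r) ^ n) (n * R ^ n / r ^ (n + 1)) r := by
  have h1 : HasDerivAt (fun r : ℝ => R / r) (-R / r ^ 2) r := by
    have := (hasDerivAt_const r R).div (hasDerivAt_id r) hr.ne'
    refine (this.congr_deriv ?_)
    simp
  have h2 := (h1.pow n).const_sub 1
  refine h2.congr_deriv ?_
  rcases n with _ | n
  · simp
  · simp only [Nat.add_sub_cancel, div_pow]
    field_simp
    ring

lemma hd_tendsto (n : ℕ) (hn : 1 ≤ n) (R : ℝ) :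
    Tendsto (fun r : ℝ => 1 - (R / r) ^ n) atTop (nhds 1) := by
  have h1 : Tendsto (fun r : ℝ => R / r) atTop (nhds 0) :=
    tendsto_const_nhds.div_atTop tendsto_id
  have h2 := (h1.pow n).const_sub 1
  rw [zero_pow (by omega), sub_zero] at h2
  exact h2

lemma hd_ofReal_integral_le {α : Type*} [MeasurableSpace α] {μ : Measure α} {h : α → ℝ}
    (hi : Integrable h μ) :
    ENNReal.ofReal (∫ x, h x ∂μ) ≤ ∫⁻ x, ENNReal.ofReal (h x) ∂μ := by
  rw [integral_eq_lintegral_pos_part_sub_lintegral_neg_part hi]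
  refine (ENNReal.ofReal_le_ofReal (sub_le_self _ ENNReal.toReal_nonneg)).trans ?_
  exact ENNReal.ofReal_toReal_le

lemma hd_ae_diff (f : ℂ → ℝ) (hf : LocallyLipschitz f) :
    ∀ᵐ x : ℂ, DifferentiableAt ℝ f x := by
  have h : ∀ k : ℕ, ∀ᵐ x : ℂ, x ∈ ball (0 : ℂ) k → DifferentiableAt ℝ f x := by
    intro k
    obtain ⟨K, hK⟩ := (hf.locallyLipschitzOn (s := closedBall (0 : ℂ) k)
      ).exists_lipschitzOnWith_of_compact (isCompact_closedBall _ _)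
    filter_upwards [(hK.mono ball_subset_closedBall).ae_differentiableWithinAt_of_mem] with x hx hm
    exact (hx hm).differentiableAt (isOpen_ball.mem_nhds hm)
  rw [← ae_all_iff] at h
  filter_upwards [h] with x hx
  obtain ⟨k, hk⟩ := exists_nat_gt ‖x‖
  exact hx k (by simpa using hk)

lemma hd_ray (n : ℕ) (hn : 1 ≤ n) (R₀ : ℝ) (hR₀ : 0 < R₀) (f : ℂ → ℝ)
    (hf : f ∈ hardDiscAdmissible R₀) (u : ℂ) (hu : ‖u‖ = 1) (F : ℂ → ℝ≥0∞)
    (hF1 : ∀ x, DifferentiableAt ℝ f x → F x = ENNReal.ofReal (‖x‖ ^ n * ‖fderiv ℝ f x‖ ^ 2))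
    (hF2 : ∀ x, ¬ DifferentiableAt ℝ f x → F x = ⊤) :
    ENNReal.ofReal (n * R₀ ^ n) ≤ ∫⁻ r in Set.Ioi (0 : ℝ), ENNReal.ofReal r * F (r * u) := by
  obtain ⟨hlip, hzero, hlim⟩ := hf
  set a : ℝ := n * R₀ ^ n with ha
  have ha0 : 0 < a := by have : (0 : ℝ) < n := by exact_mod_cast hn
                         positivity
  set g : ℝ → ℝ := fun r => f (r * u) with hg
  have hgder : ∀ r : ℝ, DifferentiableAt ℝ f (r * u) → HasDerivAt g (fderiv ℝ f (r * u) u) r := by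
    intro r hr
    have h1 : HasDerivAt (fun r : ℝ => (r : ℂ) * u) u r := by
      simpa using (Complex.ofRealCLM.hasDerivAt (x := r)).mul_const u
    exact HasFDerivAt.comp_hasDerivAt (f := fun r : ℝ => (r : ℂ) * u) r hr.hasFDerivAt h1
  set h : ℝ → ℝ := fun r => 2 * a * deriv g r - a * (a / r ^ (n + 1)) with hh
  have hpt : ∀ r : ℝ, 0 < r → ENNReal.ofReal (h r) ≤ ENNReal.ofReal r * F (r * u) := by
    intro r hr
    by_cases hd : DifferentiableAt ℝ f (r * u)
    · rw [hF1 _ hd, ← ENNReal.ofReal_mul hr.le]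
      apply ENNReal.ofReal_le_ofReal
      have hnr : ‖(r : ℂ) * u‖ = r := by simp [hu, abs_of_pos hr]
      have hD : deriv g r ^ 2 ≤ ‖fderiv ℝ f (r * u)‖ ^ 2 := by
        rw [(hgder r hd).deriv, ← sq_abs, ← Real.norm_eq_abs]
        have := (fderiv ℝ f (r * u)).le_opNorm u
        rw [hu, mul_one] at this
        gcongr
      rw [hnr]
      have hp : 0 < r ^ (n + 1) := by positivity
      have h3 : r ^ (n + 1) * deriv g r ^ 2 ≤ r ^ (n + 1) * ‖fderiv ℝ f (r * u)‖ ^ 2 := by gcongr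
      have h4 : 0 ≤ (r ^ (n + 1) * deriv g r - a) ^ 2 / r ^ (n + 1) := by positivity
      have h5 : (r ^ (n + 1) * deriv g r - a) ^ 2 / r ^ (n + 1)
          = r ^ (n + 1) * deriv g r ^ 2 - 2 * a * deriv g r + a * (a / r ^ (n + 1)) := by
        field_simp
        ring
      have h6 : r * (r ^ n * ‖fderiv ℝ f (r * u)‖ ^ 2) = r ^ (n + 1) * ‖fderiv ℝ f (r * u)‖ ^ 2 := by
        ring
      rw [h6]
      simp only [hh]
      linarith
    · rw [hF2 _ hd, ENNReal.mul_top (by simpa using hr)]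
      exact le_top
  have hglip : LocallyLipschitz g := by
    have h1 : LipschitzWith 1 (fun r : ℝ => (r : ℂ) * u) := by
      apply LipschitzWith.of_dist_le_mul
      intro x y
      rw [dist_eq_norm, dist_eq_norm, ← sub_mul, norm_mul, hu, ← Complex.ofReal_sub,
        Complex.norm_real]
      simp
    exact hlip.comp h1.locallyLipschitz
  have hkey : ∀ R : ℝ, R₀ ≤ R → ENNReal.ofReal (2 * a * g R - a * (1 - (R₀ / R) ^ n))
      ≤ ∫⁻ r in Set.Ioi (0 : ℝ), ENNReal.ofReal r * F (r * u) := by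
    intro R hR
    obtain ⟨K, hK⟩ := (hglip.locallyLipschitzOn (s := Set.uIcc R₀ R)
      ).exists_lipschitzOnWith_of_compact isCompact_uIcc
    have hac := hK.absolutelyContinuousOnInterval
    have hi1 := hac.intervalIntegrable_deriv
    have hi2 : IntervalIntegrable (fun r : ℝ => a / r ^ (n + 1)) volume R₀ R := by
      apply ContinuousOn.intervalIntegrable
      rw [Set.uIcc_of_le hR]
      apply ContinuousOn.div continuousOn_const (by fun_prop)
      intro x hx
      have : 0 < x := hR₀.trans_le hx.1
      positivity
    have e1 : ∫ r in R₀..R, deriv g r = g R := by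
      rw [hac.integral_deriv_eq_sub]
      have : g R₀ = 0 := hzero _ (by simp [hu, abs_of_pos hR₀])
      rw [this, sub_zero]
    have e2 : ∫ r in R₀..R, a / r ^ (n + 1) = 1 - (R₀ / R) ^ n := by
      rw [intervalIntegral.integral_eq_sub_of_hasDerivAt
        (f := fun r : ℝ => 1 - (R₀ / r) ^ n) _ hi2]
      · simp [hR₀.ne']
      · intro x hx
        rw [Set.uIcc_of_le hR] at hx
        exact hd_deriv n R₀ x (hR₀.trans_le hx.1)
    have e3 : ∫ r in R₀..R, h r = 2 * a * g R - a * (1 - (R₀ / R) ^ n) := by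
      rw [← e1, ← e2, ← intervalIntegral.integral_const_mul, ← intervalIntegral.integral_const_mul,
        ← intervalIntegral.integral_sub (hi1.const_mul _) (hi2.const_mul _)]
    have hi3 : IntervalIntegrable h volume R₀ R := (hi1.const_mul _).sub (hi2.const_mul _)
    rw [← e3, intervalIntegral.integral_of_le hR]
    rw [intervalIntegrable_iff_integrableOn_Ioc_of_le hR] at hi3
    refine (hd_ofReal_integral_le hi3).trans ?_
    refine (setLIntegral_mono' measurableSet_Ioc
      (fun r hr => hpt r (hR₀.trans hr.1))).trans ?_
    exact lintegral_mono_set (fun r hr => hR₀.trans hr.1)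
  have hgl : Tendsto g atTop (nhds 1) := by
    apply hlim.comp
    rw [← cobounded_eq_cocompact, ← tendsto_norm_atTop_iff_cobounded]
    refine tendsto_id.congr' ?_
    filter_upwards [eventually_ge_atTop 0] with r hr
    simp [hu, abs_of_nonneg hr]
  have hl : Tendsto (fun R => 2 * a * g R - a * (1 - (R₀ / R) ^ n)) atTop (nhds a) := by
    have := (hgl.const_mul (2 * a)).sub ((hd_tendsto n hn R₀).const_mul a)
    convert this using 2
    ring
  refine le_of_tendsto ((ENNReal.continuous_ofReal.tendsto a).comp hl) ?_
  filter_upwards [eventually_ge_atTop R₀] with R hR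
  exact hkey R hR

lemma hd_polar (F : ℂ → ℝ≥0∞) (hF : Measurable F) :
    ∫⁻ x, F x = ∫⁻ θ in Set.Ioo (-π) π, ∫⁻ r in Set.Ioi (0 : ℝ),
      ENNReal.ofReal r * F (r * (cos θ + sin θ * Complex.I)) := by
  rw [← Complex.lintegral_comp_polarCoord_symm, polarCoord_target, Measure.volume_eq_prod,
    setLIntegral_prod_symm]
  · simp [Complex.polarCoord_symm_apply]
  · apply Measurable.aemeasurable
    simp only [Complex.polarCoord_symm_apply, smul_eq_mul]
    apply Measurable.mul (by fun_prop)
    apply hF.comp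
    fun_prop

lemma hd_norm (θ : ℝ) : ‖((cos θ : ℂ) + sin θ * Complex.I)‖ = 1 := by
  rw [Complex.ofReal_cos, Complex.ofReal_sin, ← Complex.exp_mul_I]
  exact Complex.norm_exp_ofReal_mul_I θ

lemma hd_const (c : ℝ) : ∫⁻ _ in Set.Ioo (-π) π, ENNReal.ofReal c = ENNReal.ofReal (2 * π * c) := by
  rw [setLIntegral_const, Real.volume_Ioo, mul_comm, ← ENNReal.ofReal_mul (by linarith [pi_pos])]
  congr 1
  ring

lemma hd_lower (n : ℕ) (hn : 1 ≤ n) (R₀ : ℝ) (hR₀ : 0 < R₀) (f : ℂ → ℝ)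
    (hf : f ∈ hardDiscAdmissible R₀) :
    ENNReal.ofReal (2 * π * (n * R₀ ^ n)) ≤
      ∫⁻ x : ℂ, ENNReal.ofReal (‖x‖ ^ n * ‖fderiv ℝ f x‖ ^ 2) := by
  classical
  set F : ℂ → ℝ≥0∞ := fun x => if DifferentiableAt ℝ f x then
    ENNReal.ofReal (‖x‖ ^ n * ‖fderiv ℝ f x‖ ^ 2) else ⊤ with hFdef
  have hm : Measurable F := by
    apply Measurable.ite (measurableSet_of_differentiableAt ℝ f) _ measurable_const
    have := measurable_fderiv ℝ f
    fun_prop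
  have he : ∫⁻ x : ℂ, ENNReal.ofReal (‖x‖ ^ n * ‖fderiv ℝ f x‖ ^ 2) = ∫⁻ x, F x := by
    apply lintegral_congr_ae
    filter_upwards [hd_ae_diff f hf.1] with x hx
    simp [hFdef, hx]
  rw [he, hd_polar F hm, ← hd_const]
  apply lintegral_mono
  intro θ
  apply hd_ray n hn R₀ hR₀ f hf _ _ F
  · intro x hx; simp [hFdef, hx]
  · intro x hx; simp [hFdef, hx]
  · exact_mod_cast hd_norm θ

lemma hd_min_eq (ℓ : ℕ) (R₀ : ℝ) (hR₀ : 0 < R₀) :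
    hardDiscMinimizer ℓ R₀ = fun x => 1 - (R₀ / max ‖x‖ R₀) ^ (2 * ℓ) := by
  funext x
  unfold hardDiscMinimizer
  split_ifs with h
  · rw [max_eq_right h, div_self hR₀.ne']; simp
  · rw [max_eq_left (not_le.1 h).le]

lemma hd_min_mem (ℓ : ℕ) (hℓ : 1 ≤ ℓ) (R₀ : ℝ) (hR₀ : 0 < R₀) :
    hardDiscMinimizer ℓ R₀ ∈ hardDiscAdmissible R₀ := by
  refine ⟨?_, ?_, ?_⟩
  · rw [hd_min_eq ℓ R₀ hR₀]
    intro x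
    have hlm : LipschitzWith 1 (fun x : ℂ => max ‖x‖ R₀) := lipschitzWith_one_norm.max_const R₀
    have hpos : 0 < max ‖x‖ R₀ := lt_max_of_lt_right hR₀
    have hc : ContDiffAt ℝ 1 (fun r : ℝ => 1 - (R₀ / r) ^ (2 * ℓ)) (max ‖x‖ R₀) :=
      contDiffAt_const.sub ((contDiffAt_const.div contDiffAt_id hpos.ne').pow _)
    obtain ⟨K, t, ht, hK⟩ := hc.exists_lipschitzOnWith
    refine ⟨K * 1, (fun x : ℂ => max ‖x‖ R₀) ⁻¹' t, hlm.continuous.continuousAt ht, ?_⟩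
    exact hK.comp hlm.lipschitzOnWith (fun _ h => h)
  · intro x hx
    simp [hardDiscMinimizer, hx]
  · have h1 := (hd_tendsto (2 * ℓ) (by omega) R₀).comp (tendsto_norm_cocompact_atTop (E := ℂ))
    refine h1.congr' ?_
    filter_upwards [tendsto_norm_cocompact_atTop.eventually (eventually_gt_atTop R₀)] with x hx
    simp [hardDiscMinimizer, not_le.2 hx]

lemma hd_min_fderiv_le (ℓ : ℕ) (R₀ : ℝ) (hR₀ : 0 < R₀) (x : ℂ) (hx : R₀ < ‖x‖) :
    ‖fderiv ℝ (hardDiscMinimizer ℓ R₀) x‖ ≤ (2 * ℓ : ℕ) * R₀ ^ (2 * ℓ) / ‖x‖ ^ (2 * ℓ + 1) := by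
  have hp : 0 < ‖x‖ := hR₀.trans hx
  have hx0 : x ≠ 0 := norm_pos_iff.1 hp
  have hN : DifferentiableAt ℝ (fun x : ℂ => ‖x‖) x :=
    (contDiffAt_norm ℝ (n := 1) hx0).differentiableAt (by simp)
  have h1 := (hd_deriv (2 * ℓ) R₀ ‖x‖ hp).comp_hasFDerivAt x hN.hasFDerivAt
  have h2 : hardDiscMinimizer ℓ R₀ =ᶠ[nhds x]
      ((fun r : ℝ => 1 - (R₀ / r) ^ (2 * ℓ)) ∘ fun x : ℂ => ‖x‖) := by
    filter_upwards [continuous_norm.continuousAt.eventually (lt_mem_nhds hx)] with y hy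
    simp [hardDiscMinimizer, not_le.2 hy]
  rw [(h1.congr_of_eventuallyEq h2).fderiv, norm_smul]
  have h3 : ‖fderiv ℝ (fun x : ℂ => ‖x‖) x‖ ≤ 1 := by
    simpa using norm_fderiv_le_of_lipschitz ℝ (x₀ := x) (lipschitzWith_one_norm (E := ℂ))
  rw [Real.norm_of_nonneg (by positivity)]
  exact mul_le_of_le_one_right (by positivity) h3

lemma hd_min_energy (ℓ : ℕ) (hℓ : 1 ≤ ℓ) (R₀ : ℝ) (hR₀ : 0 < R₀) :
    hardDiscEnergy ℓ (hardDiscMinimizer ℓ R₀)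
      ≤ ENNReal.ofReal (2 * π * ((2 * ℓ : ℕ) * R₀ ^ (2 * ℓ))) := by
  set n := 2 * ℓ with hn
  set a : ℝ := n * R₀ ^ n with ha
  have ha0 : 0 ≤ a := by positivity
  set F : ℂ → ℝ≥0∞ := fun x => if R₀ < ‖x‖ then
    ENNReal.ofReal (‖x‖ ^ n * (a / ‖x‖ ^ (n + 1)) ^ 2) else 0 with hFdef
  have hm : Measurable F := by
    apply Measurable.ite (measurableSet_lt measurable_const measurable_norm) _ measurable_const
    fun_prop
  have h1 : hardDiscEnergy ℓ (hardDiscMinimizer ℓ R₀) ≤ ∫⁻ x, F x := by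
    unfold hardDiscEnergy
    apply lintegral_mono_ae
    have hs : ∀ᵐ x : ℂ, x ∉ sphere (0 : ℂ) R₀ :=
      measure_eq_zero_iff_ae_notMem.1 (Measure.addHaar_sphere volume (0 : ℂ) R₀)
    filter_upwards [hs] with x hx
    have hx : ‖x‖ ≠ R₀ := by simpa using hx
    rcases lt_or_gt_of_ne hx with h | h
    · have h2 : hardDiscMinimizer ℓ R₀ =ᶠ[nhds x] fun _ => 0 := by
        filter_upwards [continuous_norm.continuousAt.eventually (gt_mem_nhds h)] with y hy
        simp [hardDiscMinimizer, le_of_lt hy]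
      rw [h2.fderiv_eq]
      simp
    · simp only [hFdef, h, if_true]
      apply ENNReal.ofReal_le_ofReal
      have := hd_min_fderiv_le ℓ R₀ hR₀ x h
      gcongr
  refine h1.trans ?_
  rw [hd_polar F hm, ← hd_const]
  apply lintegral_mono
  intro θ
  have h2 : ∀ r ∈ Set.Ioi (0 : ℝ), ENNReal.ofReal r * F (r * (cos θ + sin θ * Complex.I))
      = (Set.Ioi R₀).indicator (fun r => ENNReal.ofReal (a * (a / r ^ (n + 1)))) r := by
    intro r hr
    have hr : 0 < r := hr
    have hnr : ‖(r : ℂ) * (cos θ + sin θ * Complex.I)‖ = r := by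
      rw [norm_mul, hd_norm, Complex.norm_real, mul_one, Real.norm_of_nonneg hr.le]
    simp only [hFdef, hnr]
    by_cases h : R₀ < r
    · rw [if_pos h, Set.indicator_of_mem (by exact h), ← ENNReal.ofReal_mul hr.le]
      congr 1
      field_simp
      ring
    · rw [if_neg h, Set.indicator_of_notMem (by exact h), mul_zero]
  have hder : ∀ x ∈ Set.Ici R₀, HasDerivAt (fun r : ℝ => a * (1 - (R₀ / r) ^ n))
      (a * (a / x ^ (n + 1))) x := fun x hx =>
    (hd_deriv n R₀ x (hR₀.trans_le hx)).const_mul a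
  have hnn : ∀ x ∈ Set.Ioi R₀, 0 ≤ a * (a / x ^ (n + 1)) := by
    intro x hx
    have : 0 < x := hR₀.trans hx
    positivity
  have htt := (hd_tendsto n (by omega) R₀).const_mul a
  show ∫⁻ r in Set.Ioi (0 : ℝ), ENNReal.ofReal r * F (r * (cos θ + sin θ * Complex.I)) ≤ _
  rw [setLIntegral_congr_fun measurableSet_Ioi h2]
  refine (setLIntegral_le_lintegral _ _).trans ?_
  rw [lintegral_indicator measurableSet_Ioi,
    ← ofReal_integral_eq_lintegral_ofReal (integrableOn_Ioi_deriv_of_nonneg' hder hnn htt)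
      ((ae_restrict_iff' measurableSet_Ioi).2 (Eventually.of_forall hnn)),
    integral_Ioi_of_hasDerivAt_of_nonneg' hder hnn htt]
  simp [hR₀.ne']

/-- **Scattering energy of the hard disc**: the infimum of the weighted Dirichlet
energy over admissible functions equals `4πℓ R₀^{2ℓ}`, and is attained by the
explicit minimizer; i.e. the hard-disc scattering parameter is `b_ℓ = R₀^{2ℓ}`. -/
theorem hardDisc_scattering (ℓ : ℕ) (hℓ : 1 ≤ ℓ) (R₀ : ℝ) (hR₀ : 0 < R₀) :
    (⨅ f : hardDiscAdmissible R₀, hardDiscEnergy ℓ f)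
        = ENNReal.ofReal (4 * π * ℓ * R₀ ^ (2 * ℓ))
      ∧ hardDiscMinimizer ℓ R₀ ∈ hardDiscAdmissible R₀
      ∧ hardDiscEnergy ℓ (hardDiscMinimizer ℓ R₀)
          = ENNReal.ofReal (4 * π * ℓ * R₀ ^ (2 * ℓ)) := by
  have hc : 4 * π * ℓ * R₀ ^ (2 * ℓ) = 2 * π * ((2 * ℓ : ℕ) * R₀ ^ (2 * ℓ)) := by
    push_cast
    ring
  have hmem := hd_min_mem ℓ hℓ R₀ hR₀
  have hlow : ∀ f ∈ hardDiscAdmissible R₀,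
      ENNReal.ofReal (2 * π * ((2 * ℓ : ℕ) * R₀ ^ (2 * ℓ))) ≤ hardDiscEnergy ℓ f :=
    fun f hf => hd_lower (2 * ℓ) (by omega) R₀ hR₀ f hf
  have hup := hd_min_energy ℓ hℓ R₀ hR₀
  rw [hc]
  refine ⟨le_antisymm ?_ ?_, hmem, le_antisymm hup (hlow _ hmem)⟩
  · exact (iInf_le (fun f : hardDiscAdmissible R₀ => hardDiscEnergy ℓ f) ⟨_, hmem⟩).trans hup
  · exact le_iInf fun f => hlow f f.2
end

section
/- Let H be a complex Hilbert space, let (A_n) be a sequence of bounded self-adjoint operators on H and A, K bounded self-adjoint operators on H such that 0 ≤ A_n ≤ K for all n (i.e., A_n and K − A_n are positive), K is compact, and A_n x → A x in norm for every x ∈ H. Then ‖A_n − A‖ → 0 in operator norm. In particular, strong resolvent convergence and norm resolvent convergence are equivalent for a sequence of non-negative self-adjoint operators whose resolvents are dominated by a fixed compact operator. -/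
open Filter
open scoped InnerProductSpace

/-- Quadratic-form estimate for a non-negative self-adjoint operator dominated by `K`. -/
theorem dominated_norm_sq_le
    {H : Type*} [NormedAddCommGroup H] [InnerProductSpace ℂ H] [CompleteSpace H]
    (T K : H →L[ℂ] H) (hT : IsSelfAdjoint T)
    (h0 : ∀ x : H, 0 ≤ (⟪x, T x⟫_ℂ).re)
    (hle : ∀ x : H, (⟪x, T x⟫_ℂ).re ≤ (⟪x, K x⟫_ℂ).re) (y : H) :
    ‖T y‖ ^ 2 ≤ (‖K‖ + 1) * (‖y‖ * ‖K y‖) := by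
  have hK : ∀ x : H, (⟪x, K x⟫_ℂ).re ≤ ‖x‖ * ‖K x‖ := fun x =>
    (Complex.re_le_norm _).trans (norm_inner_le_norm _ _)
  have hC : 0 < ‖K‖ + 1 := by positivity
  set C := ‖K‖ + 1 with hCdef
  have hz : (⟪T y, T (T y)⟫_ℂ).re ≤ C * ‖T y‖ ^ 2 := by
    have h1 := (hle (T y)).trans (hK (T y))
    have h2 := K.le_opNorm (T y)
    nlinarith [norm_nonneg (T y), mul_le_mul_of_nonneg_left h2 (norm_nonneg (T y))]
  have hsym : ⟪y, T (T y)⟫_ℂ = ⟪T y, T y⟫_ℂ := (hT.isSymmetric y (T y)).symm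
  have hn : (⟪T y, T y⟫_ℂ).re = ‖T y‖ ^ 2 := inner_self_eq_norm_sq (𝕜 := ℂ) (T y)
  have hexp : (⟪(C : ℂ) • y - T y, T ((C : ℂ) • y - T y)⟫_ℂ).re
      = C ^ 2 * (⟪y, T y⟫_ℂ).re - 2 * C * ‖T y‖ ^ 2 + (⟪T y, T (T y)⟫_ℂ).re := by
    simp only [map_sub, map_smul, inner_sub_left, inner_sub_right, inner_smul_left,
      inner_smul_right, hsym, Complex.conj_ofReal, Complex.sub_re, Complex.re_ofReal_mul, hn]
    ring
  have hpos := h0 ((C : ℂ) • y - T y)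
  rw [hexp] at hpos
  have h3 : C * ‖T y‖ ^ 2 ≤ C * (C * (⟪y, T y⟫_ℂ).re) := by nlinarith
  have h4 := le_of_mul_le_mul_left h3 hC
  exact h4.trans (mul_le_mul_of_nonneg_left ((hle y).trans (hK y)) hC.le)

/-- **Strong convergence dominated by a compact operator implies norm convergence.**
If `0 ≤ Aₙ ≤ K` with `K` compact and `Aₙ x → A x` for every `x`, then `‖Aₙ − A‖ → 0`.
In particular, strong and norm resolvent convergence are equivalent for a sequence of
non-negative self-adjoint operators whose resolvents are dominated by a fixed compact
operator. -/
theorem norm_convergence_of_dominated_by_compact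
    {H : Type*} [NormedAddCommGroup H] [InnerProductSpace ℂ H] [CompleteSpace H]
    (A : ℕ → H →L[ℂ] H) (Alim K : H →L[ℂ] H)
    (hA_sa : ∀ n, IsSelfAdjoint (A n)) (hAlim_sa : IsSelfAdjoint Alim)
    (hK_sa : IsSelfAdjoint K)
    (hA_nonneg : ∀ n (x : H), 0 ≤ (⟪x, A n x⟫_ℂ).re)
    (hA_le_K : ∀ n (x : H), (⟪x, A n x⟫_ℂ).re ≤ (⟪x, K x⟫_ℂ).re)
    (hK_compact : IsCompactOperator K)
    (h_strong : ∀ x : H, Tendsto (fun n => A n x) atTop (nhds (Alim x))) :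
    Tendsto (fun n => ‖A n - Alim‖) atTop (nhds 0) := by
  have hb : ∀ n y, ‖A n y‖ ^ 2 ≤ (‖K‖ + 1) * (‖y‖ * ‖K y‖) := fun n y =>
    dominated_norm_sq_le (A n) K (hA_sa n) (hA_nonneg n) (hA_le_K n) y
  have hbl : ∀ y, ‖Alim y‖ ^ 2 ≤ (‖K‖ + 1) * (‖y‖ * ‖K y‖) := fun y =>
    le_of_tendsto ((h_strong y).norm.pow 2) (Eventually.of_forall fun n => hb n y)
  have hC : 0 < ‖K‖ + 1 := by positivity
  rw [Metric.tendsto_atTop']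
  intro ε hε
  set e := ε / 4 with he
  have he0 : 0 < e := by positivity
  set δ := e ^ 2 / (2 * (‖K‖ + 1)) with hδ
  have hδ0 : 0 < δ := by positivity
  have htb : TotallyBounded (K '' Metric.closedBall (0 : H) 1) :=
    (hK_compact.isCompact_closure_image_closedBall 1).totallyBounded.subset subset_closure
  obtain ⟨t, hts, htf, htc⟩ := Metric.finite_approx_of_totallyBounded htb δ hδ0
  obtain ⟨u, hus, huf, rfl⟩ :
      ∃ u ⊆ Metric.closedBall (0 : H) 1, u.Finite ∧ K '' u = t := by
    have hts' : ∀ a : H, a ∈ t → ∃ x, x ∈ Metric.closedBall (0 : H) 1 ∧ K x = a :=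
      fun a ha => hts ha
    choose! g hg using hts'
    refine ⟨g '' t, ?_, htf.image g, ?_⟩
    · rintro _ ⟨a, ha, rfl⟩
      exact (hg a ha).1
    · rw [Set.image_image]
      ext a
      constructor
      · rintro ⟨b, hb', rfl⟩
        simpa only [(hg b hb').2] using hb'
      · intro ha
        exact ⟨a, ha, (hg a ha).2⟩
  have hev : ∀ᶠ n in atTop, ∀ x ∈ u, ‖A n x - Alim x‖ < e := by
    rw [huf.eventually_all]
    intro x _
    have := (tendsto_iff_norm_sub_tendsto_zero.1 (h_strong x))
    exact this.eventually_lt_const he0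
  obtain ⟨N, hN⟩ := eventually_atTop.1 hev
  refine ⟨N, fun n hn => ?_⟩
  rw [Real.dist_eq, sub_zero, abs_of_nonneg (norm_nonneg _)]
  refine lt_of_le_of_lt (b := 3 * e) ?_ (by rw [he]; linarith)
  refine ContinuousLinearMap.opNorm_le_of_unit_norm (by positivity) fun x hx => ?_
  have hxK : K x ∈ K '' Metric.closedBall (0 : H) 1 := ⟨x, by simp [hx], rfl⟩
  obtain ⟨_, ⟨z, hz, rfl⟩, hd⟩ := by simpa only [Set.mem_iUnion, exists_prop] using htc hxK
  rw [Metric.mem_ball, dist_eq_norm, ← map_sub] at hd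
  have hz1 : ‖z‖ ≤ 1 := by simpa using hus hz
  have hy : ‖x - z‖ ≤ 2 := (norm_sub_le x z).trans (by linarith)
  have hbd : (‖K‖ + 1) * (‖x - z‖ * ‖K (x - z)‖) ≤ e ^ 2 := by
    calc (‖K‖ + 1) * (‖x - z‖ * ‖K (x - z)‖) ≤ (‖K‖ + 1) * (2 * δ) := by gcongr
      _ = e ^ 2 := by rw [hδ]; field_simp
  have h1 : ‖A n (x - z)‖ ≤ e := (sq_le_sq₀ (norm_nonneg _) he0.le).1 ((hb n _).trans hbd)
  have h2 : ‖Alim (x - z)‖ ≤ e := (sq_le_sq₀ (norm_nonneg _) he0.le).1 ((hbl _).trans hbd)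
  have h3 := (hN n hn.le z hz).le
  have heq : (A n - Alim) x = A n (x - z) - Alim (x - z) + (A n z - Alim z) := by
    simp only [sub_apply, map_sub]; abel
  rw [heq]
  calc _ ≤ ‖A n (x - z)‖ + ‖Alim (x - z)‖ + ‖A n z - Alim z‖ :=
        (norm_add_le _ _).trans (by gcongr; exact norm_sub_le _ _)
    _ ≤ 3 * e := by linarith
end

section
/- Let ℓ ≥ 1 be an integer and let v : [0,∞) → [0,∞) be measurable with v(r) = 0 for r > R₀. Then inf { ∫_{ℝ³} (x₁² + x₂²)^ℓ ( |∇f(x)|² + ½ v(|x|) f(x)² ) dx : f ∈ C¹(ℝ³, ℝ), lim_{|x|→∞} f(x) = 1 } = c_ℓ · inf { ∫_{ℝ³} |x|^{2ℓ} ( |∇f(x)|² + ½ v(|x|) f(x)² ) dx : f ∈ C¹(ℝ³, ℝ), lim_{|x|→∞} f(x) = 1 }, where c_ℓ = ∏_{j=1}^{ℓ} 2j/(2j+1). Equivalently, with 4π(2ℓ+1) b_ℓ the value of the second infimum and b̃_ℓ := c_ℓ b_ℓ, the first infimum equals 4π(2ℓ+1) b̃_ℓ. -/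
open MeasureTheory Metric Filter Real
open scoped ENNReal


lemma polar_lint (F : EuclideanSpace ℝ (Fin 3) → ℝ≥0∞) (hF : Measurable F) :
    ∫⁻ x, F x = ∫⁻ ω : sphere (0 : EuclideanSpace ℝ (Fin 3)) 1,
      (∫⁻ r in Set.Ioi (0:ℝ), ENNReal.ofReal (r ^ 2) * F (r • (ω : EuclideanSpace ℝ (Fin 3))))
      ∂(volume : Measure (EuclideanSpace ℝ (Fin 3))).toSphere := by
  have hmp := (volume : Measure (EuclideanSpace ℝ (Fin 3))).measurePreserving_homeomorphUnitSphereProd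
  have hdim : Module.finrank ℝ (EuclideanSpace ℝ (Fin 3)) - 1 = 2 := by simp
  rw [hdim] at hmp
  have hm : Measurable (fun p : sphere (0 : EuclideanSpace ℝ (Fin 3)) 1 × Set.Ioi (0:ℝ) =>
      F ((p.2 : ℝ) • (p.1 : EuclideanSpace ℝ (Fin 3)))) := by
    apply hF.comp
    fun_prop
  calc ∫⁻ x, F x = ∫⁻ x in ({0}ᶜ : Set (EuclideanSpace ℝ (Fin 3))), F x := by
        rw [restrict_compl_singleton]
    _ = ∫⁻ x : ({0}ᶜ : Set (EuclideanSpace ℝ (Fin 3))), F x ∂(volume.comap Subtype.val) := by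
        rw [lintegral_subtype_comap (measurableSet_singleton _).compl]
    _ = ∫⁻ p, F ((p.2 : ℝ) • (p.1 : EuclideanSpace ℝ (Fin 3)))
          ∂((volume : Measure (EuclideanSpace ℝ (Fin 3))).toSphere.prod (.volumeIoiPow 2)) := by
        rw [← hmp.lintegral_comp hm]
        refine lintegral_congr fun x => ?_
        congr 1
        have hx : ‖(x : EuclideanSpace ℝ (Fin 3))‖ ≠ 0 := norm_ne_zero_iff.2 x.2
        simp [smul_smul, hx]
    _ = _ := by
        rw [lintegral_prod _ hm.aemeasurable]
        refine lintegral_congr fun ω => ?_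
        rw [Measure.volumeIoiPow, lintegral_withDensity_eq_lintegral_mul₀]
        · simp only [Pi.mul_apply]
          exact lintegral_subtype_comap measurableSet_Ioi
            (fun r : ℝ => ENNReal.ofReal (r ^ 2) * F (r • (ω : EuclideanSpace ℝ (Fin 3))))
        · fun_prop
        · exact (hm.comp (measurable_const.prodMk measurable_id)).aemeasurable

lemma lint_gauss_r (ℓ : ℕ) : ∫⁻ r in Set.Ioi (0:ℝ), ENNReal.ofReal (r ^ (2 * ℓ + 2) * exp (- r ^ 2))
    = ENNReal.ofReal (1 / 2 * Gamma (ℓ + 3 / 2)) := by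
  have h := integral_rpow_mul_exp_neg_rpow (p := 2) (q := ((2 * ℓ + 2 : ℕ) : ℝ)) two_pos
    (by linarith [Nat.cast_nonneg (α := ℝ) (2 * ℓ + 2)])
  have e : (((2 * ℓ + 2 : ℕ) : ℝ) + 1) / 2 = ℓ + 3 / 2 := by push_cast; ring
  rw [e] at h
  have hpos : 0 < Gamma ((ℓ : ℝ) + 3 / 2) := Gamma_pos_of_pos (by positivity)
  simp only [rpow_natCast, rpow_ofNat] at h
  rw [← h, ofReal_integral_eq_lintegral_ofReal]
  · by_contra hn
    rw [integral_undef hn] at h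
    linarith
  · filter_upwards [ae_restrict_mem measurableSet_Ioi] with r hr
    have : (0:ℝ) < r := hr
    positivity

lemma lint_gauss_C (ℓ : ℕ) : ∫⁻ z : ℂ, ENNReal.ofReal ((z.re ^ 2 + z.im ^ 2) ^ ℓ * exp (- (z.re ^ 2 + z.im ^ 2)))
    = ENNReal.ofReal (π * (ℓ.factorial : ℝ)) := by
  have h := Complex.integral_rpow_mul_exp_neg_rpow (p := 2) (q := ((2 * ℓ : ℕ) : ℝ)) (by norm_num)
    (by linarith [Nat.cast_nonneg (α := ℝ) (2 * ℓ)])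
  have e : (((2 * ℓ : ℕ) : ℝ) + 2) / 2 = ℓ + 1 := by push_cast; ring
  rw [e, Gamma_nat_eq_factorial, mul_div_cancel_left₀ _ (two_ne_zero)] at h
  have hpos : 0 < π * (ℓ.factorial : ℝ) := by positivity
  simp only [rpow_natCast, rpow_ofNat] at h
  have e2 : ∀ z : ℂ, (z.re ^ 2 + z.im ^ 2) = ‖z‖ ^ 2 := by
    intro z; rw [Complex.sq_norm, Complex.normSq_apply]; ring
  simp_rw [e2, ← pow_mul]
  rw [← h, ofReal_integral_eq_lintegral_ofReal]
  · by_contra hn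
    rw [integral_undef hn] at h
    linarith
  · exact Eventually.of_forall fun r => by positivity

lemma lint_gauss_E (ℓ : ℕ) : ∫⁻ x : EuclideanSpace ℝ (Fin 3),
      ENNReal.ofReal ((x 0 ^ 2 + x 1 ^ 2) ^ ℓ * exp (- ‖x‖ ^ 2))
    = ENNReal.ofReal (√π * (π * (ℓ.factorial : ℝ))) := by
  have e1 : ∀ x : EuclideanSpace ℝ (Fin 3), ‖x‖ ^ 2 = x 0 ^ 2 + x 1 ^ 2 + x 2 ^ 2 := by
    intro x; rw [EuclideanSpace.norm_sq_eq, Fin.sum_univ_three]; simp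
  have hm : Measurable (fun y : Fin 3 → ℝ => ENNReal.ofReal ((y 0 ^ 2 + y 1 ^ 2) ^ ℓ * exp (-(y 0 ^ 2 + y 1 ^ 2 + y 2 ^ 2)))) := by
    fun_prop
  have hg : ∫⁻ t : ℝ, ENNReal.ofReal (exp (- t ^ 2)) = ENNReal.ofReal (√π) := by
    have := integral_gaussian 1
    simp only [neg_mul, one_mul, div_one] at this
    rw [← this, ofReal_integral_eq_lintegral_ofReal]
    · simpa using integrable_exp_neg_mul_sq (b := 1) one_pos
    · exact Eventually.of_forall fun r => by positivity
  have h2 : ∫⁻ u : Fin 2 → ℝ, ENNReal.ofReal ((u 0 ^ 2 + u 1 ^ 2) ^ ℓ * exp (- (u 0 ^ 2 + u 1 ^ 2)))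
      = ENNReal.ofReal (π * (ℓ.factorial : ℝ)) := by
    rw [← lint_gauss_C, ← Complex.volume_preserving_equiv_pi.lintegral_comp]
    · simp [Complex.measurableEquivPi_apply]
    · fun_prop
  simp_rw [e1]
  rw [(PiLp.volume_preserving_ofLp (Fin 3)).lintegral_comp hm]
  rw [← (volume_preserving_piFinSuccAbove (fun _ : Fin 3 => ℝ) 2).symm.lintegral_comp hm]
  rw [Measure.volume_eq_prod, lintegral_prod]
  · have : ∀ (t : ℝ) (u : Fin 2 → ℝ), ENNReal.ofReal
      (((MeasurableEquiv.piFinSuccAbove (fun _ : Fin 3 => ℝ) 2).symm (t, u) 0 ^ 2 +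
      (MeasurableEquiv.piFinSuccAbove (fun _ : Fin 3 => ℝ) 2).symm (t, u) 1 ^ 2) ^ ℓ *
      exp (-((MeasurableEquiv.piFinSuccAbove (fun _ : Fin 3 => ℝ) 2).symm (t, u) 0 ^ 2 +
      (MeasurableEquiv.piFinSuccAbove (fun _ : Fin 3 => ℝ) 2).symm (t, u) 1 ^ 2 +
      (MeasurableEquiv.piFinSuccAbove (fun _ : Fin 3 => ℝ) 2).symm (t, u) 2 ^ 2))) =
      ENNReal.ofReal (exp (- t ^ 2)) *
        ENNReal.ofReal ((u 0 ^ 2 + u 1 ^ 2) ^ ℓ * exp (- (u 0 ^ 2 + u 1 ^ 2))) := by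
      intro t u
      have a0 : (MeasurableEquiv.piFinSuccAbove (fun _ : Fin 3 => ℝ) 2).symm (t, u) 0 = u 0 := rfl
      have a1 : (MeasurableEquiv.piFinSuccAbove (fun _ : Fin 3 => ℝ) 2).symm (t, u) 1 = u 1 := rfl
      have a2 : (MeasurableEquiv.piFinSuccAbove (fun _ : Fin 3 => ℝ) 2).symm (t, u) 2 = t := rfl
      rw [a0, a1, a2, ← ENNReal.ofReal_mul (by positivity), neg_add, Real.exp_add]
      ring_nf
    simp_rw [this]
    have hm2 : Measurable fun u : Fin 2 → ℝ => ENNReal.ofReal ((u 0 ^ 2 + u 1 ^ 2) ^ ℓ * exp (- (u 0 ^ 2 + u 1 ^ 2))) := by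
      fun_prop
    simp_rw [lintegral_const_mul _ hm2, h2]
    rw [lintegral_mul_const _ (by fun_prop), hg, ← ENNReal.ofReal_mul (by positivity)]
  · exact (hm.comp (MeasurableEquiv.measurable _)).aemeasurable

noncomputable def angW (ℓ : ℕ) : ℝ≥0∞ := ∫⁻ ω : sphere (0 : EuclideanSpace ℝ (Fin 3)) 1,
    ENNReal.ofReal (((ω : EuclideanSpace ℝ (Fin 3)) 0 ^ 2 + (ω : EuclideanSpace ℝ (Fin 3)) 1 ^ 2) ^ ℓ)
    ∂(volume : Measure (EuclideanSpace ℝ (Fin 3))).toSphere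

lemma angW_mul (ℓ : ℕ) : angW ℓ * ENNReal.ofReal (1 / 2 * Gamma (ℓ + 3 / 2)) =
    ENNReal.ofReal (√π * (π * (ℓ.factorial : ℝ))) := by
  rw [← lint_gauss_E, polar_lint _ (by fun_prop), angW, ← lintegral_mul_const _ (by fun_prop),
    ← lint_gauss_r]
  refine lintegral_congr fun ω => ?_
  rw [← lintegral_const_mul _ (by fun_prop)]
  refine setLIntegral_congr_fun measurableSet_Ioi fun r hr => ?_
  have hr0 : (0:ℝ) < r := hr
  have hω : ‖(ω : EuclideanSpace ℝ (Fin 3))‖ = 1 := by simp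
  simp only [norm_smul, hω, mul_one, norm_eq_abs, sq_abs, PiLp.smul_apply, smul_eq_mul]
  rw [← ENNReal.ofReal_mul (by positivity), ← ENNReal.ofReal_mul (by positivity)]
  congr 1
  have : (r * (ω : EuclideanSpace ℝ (Fin 3)) 0) ^ 2 + (r * (ω : EuclideanSpace ℝ (Fin 3)) 1) ^ 2
    = r ^ 2 * ((ω : EuclideanSpace ℝ (Fin 3)) 0 ^ 2 + (ω : EuclideanSpace ℝ (Fin 3)) 1 ^ 2) := by ring
  rw [this, mul_pow]
  ring

lemma angW_succ (ℓ : ℕ) : angW (ℓ + 1) = ENNReal.ofReal ((2 * ((ℓ + 1 : ℕ) : ℝ)) / (2 * ((ℓ + 1 : ℕ) : ℝ) + 1)) * angW ℓ := by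
  have h1 := angW_mul (ℓ + 1)
  have h0 := angW_mul ℓ
  have hG : 0 < Gamma ((ℓ : ℝ) + 3 / 2) := Gamma_pos_of_pos (by positivity)
  have e : (((ℓ + 1 : ℕ) : ℝ) + 3 / 2) = ((ℓ : ℝ) + 3 / 2) + 1 := by push_cast; ring
  rw [e, Gamma_add_one (by positivity)] at h1
  have hpos : ENNReal.ofReal (1 / 2 * (((ℓ : ℝ) + 3 / 2) * Gamma ((ℓ : ℝ) + 3 / 2))) ≠ 0 := by
    rw [Ne, ENNReal.ofReal_eq_zero, not_le]; positivity
  rw [← ENNReal.mul_left_inj hpos ENNReal.ofReal_ne_top, h1]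
  have : 1 / 2 * (((ℓ : ℝ) + 3 / 2) * Gamma ((ℓ : ℝ) + 3 / 2)) = ((ℓ : ℝ) + 3 / 2) * (1 / 2 * Gamma ((ℓ : ℝ) + 3 / 2)) := by ring
  rw [this, ENNReal.ofReal_mul (p := (ℓ : ℝ) + 3 / 2) (by positivity)]
  rw [show ∀ a b c d : ℝ≥0∞, a * b * (c * d) = a * c * (b * d) by intros; ring, h0,
    ← ENNReal.ofReal_mul (by positivity), ← ENNReal.ofReal_mul (by positivity)]
  congr 1
  rw [Nat.factorial_succ]
  push_cast
  field_simp
  ring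

lemma angW_eq (ℓ : ℕ) : angW ℓ = ENNReal.ofReal (∏ j ∈ Finset.Icc 1 ℓ, (2 * (j : ℝ)) / (2 * j + 1)) * angW 0 := by
  induction ℓ with
  | zero => simp
  | succ n ih =>
    rw [angW_succ, ih, Finset.prod_Icc_succ_top (by omega), ← mul_assoc, ← ENNReal.ofReal_mul (by positivity)]
    congr 2
    ring

lemma angW_ne_zero (ℓ : ℕ) : angW ℓ ≠ 0 := by
  intro h
  have h1 := angW_mul ℓ
  rw [h, zero_mul, eq_comm, ENNReal.ofReal_eq_zero] at h1
  have : 0 < √π * (π * (ℓ.factorial : ℝ)) := by positivity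
  linarith

lemma angW_ne_top (ℓ : ℕ) : angW ℓ ≠ ⊤ := by
  intro h
  have h1 := angW_mul ℓ
  have hG : 0 < Gamma ((ℓ : ℝ) + 3 / 2) := Gamma_pos_of_pos (by positivity)
  rw [h, ENNReal.top_mul] at h1
  · exact ENNReal.ofReal_ne_top h1.symm
  · rw [Ne, ENNReal.ofReal_eq_zero, not_le]; positivity

noncomputable def en1 (ℓ : ℕ) (v : ℝ → ℝ) (φ : ℝ → ℝ) : ℝ≥0∞ :=
  ∫⁻ r in Set.Ioi (0:ℝ), ENNReal.ofReal (r ^ (2 * ℓ + 2) * (deriv φ r ^ 2 + 1 / 2 * v r * φ r ^ 2))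

lemma en_lower (ℓ : ℕ) (v : ℝ → ℝ) (hv_meas : Measurable v) (hv_nonneg : ∀ r, 0 ≤ v r)
    (w : EuclideanSpace ℝ (Fin 3) → ℝ) (hw : Continuous w) (hw0 : ∀ x, 0 ≤ w x)
    (hwh : ∀ (r : ℝ) x, 0 < r → w (r • x) = r ^ (2 * ℓ) * w x)
    (I : ℝ≥0∞) (hI : ∀ φ : ℝ → ℝ, ContDiff ℝ 1 φ → Tendsto φ atTop (nhds 1) → I ≤ en1 ℓ v φ)
    (f : EuclideanSpace ℝ (Fin 3) → ℝ) (hf : ContDiff ℝ 1 f)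
    (hf1 : Tendsto f (cocompact (EuclideanSpace ℝ (Fin 3))) (nhds 1)) :
    (∫⁻ ω : sphere (0 : EuclideanSpace ℝ (Fin 3)) 1, ENNReal.ofReal (w ω)
      ∂(volume : Measure (EuclideanSpace ℝ (Fin 3))).toSphere) * I ≤
    ∫⁻ x : EuclideanSpace ℝ (Fin 3), ENNReal.ofReal (w x *
        (‖fderiv ℝ f x‖ ^ 2 + (1 / 2) * v ‖x‖ * (f x) ^ 2)) := by
  have hfd : Continuous (fderiv ℝ f) := hf.continuous_fderiv one_ne_zero
  have hfc : Continuous f := hf.continuous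
  rw [polar_lint _ (by fun_prop), ← lintegral_mul_const _ (by fun_prop)]
  refine lintegral_mono fun ω => ?_
  have hω : ‖(ω : EuclideanSpace ℝ (Fin 3))‖ = 1 := by simp
  have hφ : ContDiff ℝ 1 (fun r : ℝ => f (r • (ω : EuclideanSpace ℝ (Fin 3)))) :=
    hf.comp (contDiff_id.smul contDiff_const)
  have hφ1 : Tendsto (fun r : ℝ => f (r • (ω : EuclideanSpace ℝ (Fin 3)))) atTop (nhds 1) := by
    refine hf1.comp ?_
    rw [← Metric.cobounded_eq_cocompact, ← comap_norm_atTop, tendsto_comap_iff]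
    have : (norm ∘ fun r : ℝ => r • (ω : EuclideanSpace ℝ (Fin 3))) = fun r => |r| := by
      ext r; simp [norm_smul]
    rw [this]
    exact tendsto_abs_atTop_atTop
  refine (mul_le_mul_right (hI _ hφ hφ1) _).trans ?_
  have hdc : Continuous (deriv (fun r : ℝ => f (r • (ω : EuclideanSpace ℝ (Fin 3))))) :=
    hφ.continuous_deriv le_rfl
  have hφc := hφ.continuous
  rw [en1, ← lintegral_const_mul _ (by fun_prop)]
  refine setLIntegral_mono' measurableSet_Ioi fun r hr => ?_
  have hr0 : (0:ℝ) < r := hr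
  rw [← ENNReal.ofReal_mul (hw0 _), ← ENNReal.ofReal_mul (by positivity)]
  apply ENNReal.ofReal_le_ofReal
  have hd : HasDerivAt (fun r : ℝ => f (r • (ω : EuclideanSpace ℝ (Fin 3))))
      (fderiv ℝ f (r • (ω : EuclideanSpace ℝ (Fin 3))) (ω : EuclideanSpace ℝ (Fin 3))) r := by
    have h1 : HasDerivAt (fun r : ℝ => r • (ω : EuclideanSpace ℝ (Fin 3))) (ω : EuclideanSpace ℝ (Fin 3)) r := by
      simpa using (hasDerivAt_id r).smul_const (ω : EuclideanSpace ℝ (Fin 3))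
    exact ((hf.differentiable one_ne_zero) _).hasFDerivAt.comp_hasDerivAt r h1
  rw [hd.deriv, hwh _ _ hr0, norm_smul, hω, mul_one, norm_eq_abs, abs_of_pos hr0]
  have hle : fderiv ℝ f (r • (ω : EuclideanSpace ℝ (Fin 3))) (ω : EuclideanSpace ℝ (Fin 3)) ^ 2 ≤
      ‖fderiv ℝ f (r • (ω : EuclideanSpace ℝ (Fin 3)))‖ ^ 2 := by
    rw [← sq_abs]
    have := (fderiv ℝ f (r • (ω : EuclideanSpace ℝ (Fin 3)))).le_opNorm (ω : EuclideanSpace ℝ (Fin 3))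
    rw [hω, mul_one, norm_eq_abs] at this
    gcongr
  have hwω := hw0 ω
  calc _ = w ω * r ^ (2 * ℓ + 2) * (fderiv ℝ f (r • (ω : EuclideanSpace ℝ (Fin 3))) (ω : EuclideanSpace ℝ (Fin 3)) ^ 2 + 1 / 2 * v r * f (r • (ω : EuclideanSpace ℝ (Fin 3))) ^ 2) := by ring
    _ ≤ w ω * r ^ (2 * ℓ + 2) * (‖fderiv ℝ f (r • (ω : EuclideanSpace ℝ (Fin 3)))‖ ^ 2 + 1 / 2 * v r * f (r • (ω : EuclideanSpace ℝ (Fin 3))) ^ 2) := by gcongr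
    _ = _ := by ring

lemma en_upper (ℓ : ℕ) (v : ℝ → ℝ) (hv_meas : Measurable v)
    (w : EuclideanSpace ℝ (Fin 3) → ℝ) (hw : Continuous w) (hw0 : ∀ x, 0 ≤ w x)
    (hwh : ∀ (r : ℝ) x, 0 < r → w (r • x) = r ^ (2 * ℓ) * w x)
    (φ : ℝ → ℝ) (hφ : ContDiff ℝ 1 φ) (hφ1 : Tendsto φ atTop (nhds 1)) (δ : ℝ) (hδ : 0 < δ)
    (hφ0 : ∀ r < δ, φ r = 0) :
    ∃ f : EuclideanSpace ℝ (Fin 3) → ℝ, (ContDiff ℝ 1 f ∧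
      Tendsto f (cocompact (EuclideanSpace ℝ (Fin 3))) (nhds 1)) ∧
    ∫⁻ x : EuclideanSpace ℝ (Fin 3), ENNReal.ofReal (w x *
        (‖fderiv ℝ f x‖ ^ 2 + (1 / 2) * v ‖x‖ * (f x) ^ 2)) ≤
    (∫⁻ ω : sphere (0 : EuclideanSpace ℝ (Fin 3)) 1, ENNReal.ofReal (w ω)
      ∂(volume : Measure (EuclideanSpace ℝ (Fin 3))).toSphere) * en1 ℓ v φ := by
  have hf : ContDiff ℝ 1 (fun x : EuclideanSpace ℝ (Fin 3) => φ ‖x‖) := by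
    rw [contDiff_iff_contDiffAt]
    intro x
    by_cases hx : x = 0
    · have : (fun x : EuclideanSpace ℝ (Fin 3) => φ ‖x‖) =ᶠ[nhds x] fun _ => 0 := by
        subst hx
        filter_upwards [ball_mem_nhds (0 : EuclideanSpace ℝ (Fin 3)) hδ] with y hy
        exact hφ0 _ (by simpa using hy)
      exact contDiffAt_const.congr_of_eventuallyEq this
    · exact hφ.contDiffAt.comp x (contDiffAt_norm ℝ hx)
  refine ⟨fun x => φ ‖x‖, ⟨hf, hφ1.comp tendsto_norm_cocompact_atTop⟩, ?_⟩
  have hfd : Continuous (fderiv ℝ (fun x : EuclideanSpace ℝ (Fin 3) => φ ‖x‖)) := hf.continuous_fderiv one_ne_zero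
  have hφc := hφ.continuous
  have hdc : Continuous (deriv φ) := hφ.continuous_deriv le_rfl
  rw [polar_lint _ (by fun_prop), ← lintegral_mul_const _ (by fun_prop)]
  refine lintegral_mono fun ω => ?_
  have hω : ‖(ω : EuclideanSpace ℝ (Fin 3))‖ = 1 := by simp
  rw [en1, ← lintegral_const_mul _ (by fun_prop)]
  refine setLIntegral_mono' measurableSet_Ioi fun r hr => ?_
  have hr0 : (0:ℝ) < r := hr
  rw [← ENNReal.ofReal_mul (hw0 _), ← ENNReal.ofReal_mul (by positivity)]
  apply ENNReal.ofReal_le_ofReal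
  have hn : ‖r • (ω : EuclideanSpace ℝ (Fin 3))‖ = r := by
    rw [norm_smul, hω, mul_one, norm_eq_abs, abs_of_pos hr0]
  have hne : r • (ω : EuclideanSpace ℝ (Fin 3)) ≠ 0 := by
    rw [← norm_ne_zero_iff, hn]; exact hr0.ne'
  have hle : ‖fderiv ℝ (fun x : EuclideanSpace ℝ (Fin 3) => φ ‖x‖) (r • (ω : EuclideanSpace ℝ (Fin 3)))‖ ^ 2 ≤ deriv φ r ^ 2 := by
    rw [← sq_abs (deriv φ r)]
    have h1 : HasDerivAt φ (deriv φ r) ‖r • (ω : EuclideanSpace ℝ (Fin 3))‖ := by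
      rw [hn]; exact ((hφ.differentiable one_ne_zero) r).hasDerivAt
    have h2 := ((contDiffAt_norm (n := 1) ℝ hne).differentiableAt one_ne_zero).hasFDerivAt
    have h3 := h1.comp_hasFDerivAt _ h2
    have h4 : fderiv ℝ (fun x : EuclideanSpace ℝ (Fin 3) => φ ‖x‖) (r • (ω : EuclideanSpace ℝ (Fin 3))) = _ := h3.fderiv
    rw [h4, norm_smul, norm_eq_abs]
    have h5 : ‖fderiv ℝ (fun x : EuclideanSpace ℝ (Fin 3) => ‖x‖) (r • (ω : EuclideanSpace ℝ (Fin 3)))‖ ≤ 1 := by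
      simpa using norm_fderiv_le_of_lipschitz ℝ (lipschitzWith_one_norm (E := EuclideanSpace ℝ (Fin 3)))
    gcongr
    exact mul_le_of_le_one_right (abs_nonneg _) h5
  have hwω := hw0 ω
  simp only [hwh _ _ hr0, hn]
  calc _ = w ω * r ^ (2 * ℓ + 2) * (‖fderiv ℝ (fun x : EuclideanSpace ℝ (Fin 3) => φ ‖x‖) (r • (ω : EuclideanSpace ℝ (Fin 3)))‖ ^ 2 + 1 / 2 * v r * φ r ^ 2) := by ring
    _ ≤ w ω * r ^ (2 * ℓ + 2) * (deriv φ r ^ 2 + 1 / 2 * v r * φ r ^ 2) := by gcongr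
    _ = _ := by ring

lemma cutoff (ℓ : ℕ) (v : ℝ → ℝ) (hv_meas : Measurable v) (hv_nonneg : ∀ r, 0 ≤ v r)
    (J : ℝ≥0∞) (hJ : ∀ φ : ℝ → ℝ, ContDiff ℝ 1 φ → Tendsto φ atTop (nhds 1) →
      (∃ δ > 0, ∀ r < δ, φ r = 0) → J ≤ en1 ℓ v φ)
    (φ : ℝ → ℝ) (hφ : ContDiff ℝ 1 φ) (hφ1 : Tendsto φ atTop (nhds 1)) : J ≤ en1 ℓ v φ := by
  by_cases htop : en1 ℓ v φ = ⊤
  · rw [htop]; exact le_top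
  set χ : ℝ → ℝ := fun s => smoothTransition (s - 1) with hχ
  have hχC : ContDiff ℝ 1 χ := by
    have : ContDiff ℝ 1 smoothTransition := smoothTransition.contDiff (n := 1)
    exact this.comp (contDiff_id.sub contDiff_const)
  have hχ0 : ∀ s ≤ 1, χ s = 0 := fun s hs => smoothTransition.zero_of_nonpos (by linarith)
  have hχ1 : ∀ s, 2 ≤ s → χ s = 1 := fun s hs => smoothTransition.one_of_one_le (by linarith)
  have hχn : ∀ s, 0 ≤ χ s := fun s => smoothTransition.nonneg _
  have hχle : ∀ s, χ s ≤ 1 := fun s => smoothTransition.le_one _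
  have hχd : ∀ s, 2 < s → deriv χ s = 0 := by
    intro s hs
    have : χ =ᶠ[nhds s] fun _ => 1 := by
      filter_upwards [lt_mem_nhds hs] with y hy using hχ1 y hy.le
    rw [this.deriv_eq, deriv_const]
  have hχdc : Continuous (deriv χ) := hχC.continuous_deriv le_rfl
  have hφc := hφ.continuous
  have hφdc : Continuous (deriv φ) := hφ.continuous_deriv le_rfl
  obtain ⟨D, hD⟩ := (isCompact_Icc (a := (0:ℝ)) (b := 2)).exists_bound_of_continuousOn
    (f := fun s => s * deriv χ s) (by fun_prop)
  obtain ⟨M, hM⟩ := (isCompact_Icc (a := (0:ℝ)) (b := 2)).exists_bound_of_continuousOn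
    (f := φ) (by fun_prop)
  let φn : ℕ → ℝ → ℝ := fun n r => φ r * χ ((n + 1 : ℝ) * r)
  have hφnC : ∀ n, ContDiff ℝ 1 (φn n) := fun n =>
    hφ.mul (hχC.comp (contDiff_const.mul contDiff_id))
  have hφnd : ∀ n r, deriv (φn n) r = deriv φ r * χ ((n + 1 : ℝ) * r) + φ r * ((n + 1 : ℝ) * deriv χ ((n + 1 : ℝ) * r)) := by
    intro n r
    have h1 : HasDerivAt (fun r : ℝ => (n + 1 : ℝ) * r) (n + 1 : ℝ) r := by
      simpa using (hasDerivAt_id r).const_mul (n + 1 : ℝ)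
    have h2 := ((hχC.differentiable one_ne_zero) ((n + 1 : ℝ) * r)).hasDerivAt.comp r h1
    have h3 := ((hφ.differentiable one_ne_zero) r).hasDerivAt.mul h2
    have h4 : deriv (φn n) r = _ := h3.deriv
    rw [h4]
    simp only [Function.comp]
    ring
  have hlarge : ∀ r : ℝ, 0 < r → ∀ᶠ n : ℕ in atTop, 2 < (n + 1 : ℝ) * r := by
    intro r hr
    filter_upwards [eventually_gt_atTop ⌈2 / r⌉₊] with n hn
    have : 2 / r < n := (Nat.le_ceil _).trans_lt (by exact_mod_cast hn)
    rw [div_lt_iff₀ hr] at this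
    nlinarith
  have hJn : ∀ n, J ≤ en1 ℓ v (φn n) := by
    intro n
    have hn : (0:ℝ) < n + 1 := by positivity
    refine hJ _ (hφnC n) ?_ ⟨1 / (n + 1), by positivity, ?_⟩
    · refine hφ1.congr' ?_
      filter_upwards [eventually_ge_atTop (2 : ℝ)] with r hr
      have : 2 ≤ (n + 1 : ℝ) * r := by nlinarith [Nat.cast_nonneg (α := ℝ) n]
      simp [φn, hχ1 _ this]
    · intro r hr
      have : (n + 1 : ℝ) * r ≤ 1 := by
        rw [lt_div_iff₀ hn] at hr; linarith
      simp [φn, hχ0 _ this]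
  have hlim : Tendsto (fun n => en1 ℓ v (φn n)) atTop (nhds (en1 ℓ v φ)) := by
    unfold en1
    refine tendsto_lintegral_of_dominated_convergence
      (fun r => 2 * ENNReal.ofReal (r ^ (2 * ℓ + 2) * (deriv φ r ^ 2 + 1 / 2 * v r * φ r ^ 2))
        + (Set.Icc (0:ℝ) 2).indicator (fun r => ENNReal.ofReal (2 * r ^ (2 * ℓ) * (M ^ 2 * D ^ 2))) r) ?_ ?_ ?_ ?_
    · intro n
      have h1 := (hφnC n).continuous
      have h2 : Continuous (deriv (φn n)) := (hφnC n).continuous_deriv le_rfl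
      fun_prop
    · intro n
      filter_upwards [ae_restrict_mem measurableSet_Ioi] with r hr
      have hr0 : (0:ℝ) < r := hr
      have hvr := hv_nonneg r
      set s : ℝ := (n + 1 : ℝ) * r with hs
      have hs0 : 0 < s := by positivity
      have hrs : r ≤ s := by nlinarith [Nat.cast_nonneg (α := ℝ) n]
      have hc0 := hχn s
      have hc1 := hχle s
      have hc2 : χ s ^ 2 ≤ 1 := by nlinarith
      have hpot : φn n r ^ 2 ≤ φ r ^ 2 := by
        simp only [φn, ← hs, mul_pow]
        exact mul_le_of_le_one_right (sq_nonneg _) hc2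
      have hdd : deriv φ r ^ 2 * χ s ^ 2 ≤ deriv φ r ^ 2 := mul_le_of_le_one_right (sq_nonneg _) hc2
      by_cases hs2 : s ≤ 2
      · have hrmem : r ∈ Set.Icc (0:ℝ) 2 := ⟨hr0.le, hrs.trans hs2⟩
        rw [Set.indicator_of_mem hrmem, ← ENNReal.ofReal_ofNat 2, ← ENNReal.ofReal_mul (by positivity),
          ← ENNReal.ofReal_add (by positivity) (by positivity)]
        apply ENNReal.ofReal_le_ofReal
        have hM2 : φ r ^ 2 ≤ M ^ 2 := by
          have := hM r hrmem
          rw [norm_eq_abs] at this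
          rw [← sq_abs]; gcongr
        have hD2 : (s * deriv χ s) ^ 2 ≤ D ^ 2 := by
          have := hD s ⟨hs0.le, hs2⟩
          simp only [norm_eq_abs] at this
          rw [← sq_abs]; gcongr
        have hMD : φ r ^ 2 * (s * deriv χ s) ^ 2 ≤ M ^ 2 * D ^ 2 := by gcongr
        rw [hφnd n r, ← hs]
        have h1 : r ^ 2 * (deriv φ r * χ s + φ r * ((n + 1 : ℝ) * deriv χ s)) ^ 2 ≤
            2 * (r ^ 2 * deriv φ r ^ 2) + 2 * (M ^ 2 * D ^ 2) := by
          have e : r * (deriv φ r * χ s + φ r * ((n + 1 : ℝ) * deriv χ s)) = r * deriv φ r * χ s + φ r * (s * deriv χ s) := by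
            rw [hs]; ring
          rw [← mul_pow, e]
          have h2 : r ^ 2 * (deriv φ r ^ 2 * χ s ^ 2) ≤ r ^ 2 * deriv φ r ^ 2 := by gcongr
          nlinarith [sq_nonneg (r * deriv φ r * χ s - φ r * (s * deriv χ s))]
        have h3 : r ^ 2 * (1 / 2 * v r * φn n r ^ 2) ≤ 2 * (r ^ 2 * (1 / 2 * v r * φ r ^ 2)) := by
          have : r ^ 2 * (1 / 2 * v r * φn n r ^ 2) ≤ r ^ 2 * (1 / 2 * v r * φ r ^ 2) := by gcongr
          have : 0 ≤ r ^ 2 * (1 / 2 * v r * φ r ^ 2) := by positivity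
          linarith
        calc _ = r ^ (2 * ℓ) * (r ^ 2 * (deriv φ r * χ s + φ r * ((n + 1 : ℝ) * deriv χ s)) ^ 2 + r ^ 2 * (1 / 2 * v r * φn n r ^ 2)) := by ring
          _ ≤ r ^ (2 * ℓ) * ((2 * (r ^ 2 * deriv φ r ^ 2) + 2 * (M ^ 2 * D ^ 2)) + 2 * (r ^ 2 * (1 / 2 * v r * φ r ^ 2))) := by gcongr
          _ = _ := by ring
      · push Not at hs2
        refine le_trans ?_ le_self_add
        refine le_trans ?_ (le_mul_of_one_le_left' one_le_two)
        apply ENNReal.ofReal_le_ofReal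
        rw [hφnd n r, ← hs, hχd s hs2, hχ1 s hs2.le]
        simp only [mul_one, mul_zero, add_zero]
        gcongr
    · rw [lintegral_add_right _ (by
        refine Measurable.indicator ?_ measurableSet_Icc
        fun_prop)]
      refine ENNReal.add_ne_top.2 ⟨?_, ?_⟩
      · rw [lintegral_const_mul _ (by fun_prop)]
        exact ENNReal.mul_ne_top (by simp) htop
      · refine ne_top_of_le_ne_top ?_ (setLIntegral_le_lintegral _ _)
        rw [lintegral_indicator measurableSet_Icc]
        have : IntegrableOn (fun r : ℝ => 2 * r ^ (2 * ℓ) * (M ^ 2 * D ^ 2)) (Set.Icc 0 2) :=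
          Continuous.integrableOn_Icc (by fun_prop)
        exact this.lintegral_lt_top.ne
    · filter_upwards [ae_restrict_mem measurableSet_Ioi] with r hr
      refine tendsto_const_nhds.congr' ?_
      filter_upwards [hlarge r hr] with n hn
      rw [hφnd n r, hχd _ hn, hχ1 _ hn.le]
      simp [φn, hχ1 _ hn.le]
  exact ge_of_tendsto' hlim hJn

lemma inf_eq (ℓ : ℕ) (v : ℝ → ℝ) (hv_meas : Measurable v) (hv_nonneg : ∀ r, 0 ≤ v r)
    (w : EuclideanSpace ℝ (Fin 3) → ℝ) (hw : Continuous w) (hw0 : ∀ x, 0 ≤ w x)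
    (hwh : ∀ (r : ℝ) x, 0 < r → w (r • x) = r ^ (2 * ℓ) * w x) (W : ℝ≥0∞)
    (hW : (∫⁻ ω : sphere (0 : EuclideanSpace ℝ (Fin 3)) 1, ENNReal.ofReal (w ω)
      ∂(volume : Measure (EuclideanSpace ℝ (Fin 3))).toSphere) = W) (hW0 : W ≠ 0) (hWt : W ≠ ⊤) :
    (⨅ f : {f : EuclideanSpace ℝ (Fin 3) → ℝ // ContDiff ℝ 1 f ∧
        Filter.Tendsto f (Filter.cocompact (EuclideanSpace ℝ (Fin 3))) (nhds 1)},
      ∫⁻ x : EuclideanSpace ℝ (Fin 3), ENNReal.ofReal (w x *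
        (‖fderiv ℝ f.1 x‖ ^ 2 + (1 / 2) * v ‖x‖ * (f.1 x) ^ 2)))
    = W * ⨅ φ : {φ : ℝ → ℝ // ContDiff ℝ 1 φ ∧ Tendsto φ atTop (nhds 1) ∧ (∃ δ > 0, ∀ r < δ, φ r = 0)},
      en1 ℓ v φ.1 := by
  subst hW
  apply le_antisymm
  · rw [ENNReal.mul_iInf_of_ne hW0 hWt]
    refine le_iInf fun ⟨φ, h1, h2, δ, hδ, h3⟩ => ?_
    obtain ⟨f, hf, hle⟩ := en_upper ℓ v hv_meas w hw hw0 hwh φ h1 h2 δ hδ h3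
    exact iInf_le_of_le ⟨f, hf⟩ hle
  · refine le_iInf fun ⟨f, hf, hf1⟩ => ?_
    refine en_lower ℓ v hv_meas hv_nonneg w hw hw0 hwh _ ?_ f hf hf1
    refine cutoff ℓ v hv_meas hv_nonneg _ ?_
    intro φ h1 h2 h3
    exact iInf_le (fun φ : {φ : ℝ → ℝ // ContDiff ℝ 1 φ ∧ Tendsto φ atTop (nhds 1) ∧ (∃ δ > 0, ∀ r < δ, φ r = 0)} => en1 ℓ v φ.1) ⟨φ, h1, h2, h3⟩

/-- **Comparison of the `|z|^{2ℓ}`- and `|x|^{2ℓ}`-weighted scattering energies in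
`ℝ³`**: for a compactly supported non-negative radial potential `v`, the infimum with
weight `(x₁²+x₂²)^ℓ` equals `c_ℓ = ∏_{j=1}^ℓ 2j/(2j+1)` times the infimum with weight
`|x|^{2ℓ}`; i.e. with the latter equal to `4π(2ℓ+1) b_ℓ`, the former equals
`4π(2ℓ+1) b̃_ℓ` where `b̃_ℓ = c_ℓ b_ℓ`. -/
theorem weighted_scattering_energy_comparison (ℓ : ℕ) (hℓ : 1 ≤ ℓ)
    (v : ℝ → ℝ) (hv_meas : Measurable v) (hv_nonneg : ∀ r, 0 ≤ v r)
    (R₀ : ℝ) (hv_supp : ∀ r : ℝ, R₀ < r → v r = 0) :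
    (⨅ f : {f : EuclideanSpace ℝ (Fin 3) → ℝ // ContDiff ℝ 1 f ∧
        Filter.Tendsto f (Filter.cocompact (EuclideanSpace ℝ (Fin 3))) (nhds 1)},
      ∫⁻ x : EuclideanSpace ℝ (Fin 3), ENNReal.ofReal ((x 0 ^ 2 + x 1 ^ 2) ^ ℓ *
        (‖fderiv ℝ f.1 x‖ ^ 2 + (1 / 2) * v ‖x‖ * (f.1 x) ^ 2)))
      = ENNReal.ofReal (∏ j ∈ Finset.Icc 1 ℓ, (2 * (j : ℝ)) / (2 * j + 1)) *
        ⨅ f : {f : EuclideanSpace ℝ (Fin 3) → ℝ // ContDiff ℝ 1 f ∧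
            Filter.Tendsto f (Filter.cocompact (EuclideanSpace ℝ (Fin 3))) (nhds 1)},
          ∫⁻ x : EuclideanSpace ℝ (Fin 3), ENNReal.ofReal (‖x‖ ^ (2 * ℓ) *
            (‖fderiv ℝ f.1 x‖ ^ 2 + (1 / 2) * v ‖x‖ * (f.1 x) ^ 2)) := by
  rw [inf_eq ℓ v hv_meas hv_nonneg (fun x => (x 0 ^ 2 + x 1 ^ 2) ^ ℓ) (by fun_prop)
      (fun x => by positivity) ?_ (angW ℓ) rfl (angW_ne_zero ℓ) (angW_ne_top ℓ),
    inf_eq ℓ v hv_meas hv_nonneg (fun x => ‖x‖ ^ (2 * ℓ)) (by fun_prop)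
      (fun x => by positivity) ?_ (angW 0) ?_ (angW_ne_zero 0) (angW_ne_top 0),
    angW_eq, mul_assoc]
  · intro r x hr
    simp [norm_smul, mul_pow, abs_of_pos hr]
  · simp [angW]
  · intro r x hr
    have : (r * x 0) ^ 2 + (r * x 1) ^ 2 = r ^ 2 * (x 0 ^ 2 + x 1 ^ 2) := by ring
    simp only [PiLp.smul_apply, smul_eq_mul]
    rw [this, mul_pow, pow_mul]
end
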